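/- arXiv:1906.01172 — 6 statements merged into one kernel-verified Lean document; each statement's English description precedes it below -/
import Mathlib

section
/- The group G(ℚ) is the disjoint union of the four double cosets P(ℚ), P^ξ(ℚ)𝔴₁P(ℚ), P^ξ(ℚ)𝔴₀P(ℚ), and P^ξ(ℚ)n(ξ)𝔴₀P(ℚ). Moreover, for g ∈ G(ℚ): g ∈ P(ℚ) if and only if ⟨g e₁, ξ⟩ = 0 and ⟨g e₁, e₁⟩ = 0; g ∈ P^ξ(ℚ)𝔴₀P(ℚ) if and only if ⟨g e₁, ξ⟩ = 0 and ⟨g e₁, e₁⟩ ≠ 0; g ∈ P^ξ(ℚ)𝔴₁P(ℚ) if and only if ⟨g e₁, ξ⟩ ≠ 0 and ⟨g e₁, e₁⟩ = 0; and g ∈ P^ξ(ℚ)n(ξ)𝔴₀P(ℚ) if and only if ⟨g e₁, ξ⟩ ≠ 0 and ⟨g e₁, e₁⟩ ≠ 0. -/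
open Matrix

/-- Index type for `V₁ = ℚ^m`, written as `⟨e₀⟩ ⊕ V₀ ⊕ ⟨e₀'⟩` with `V₀ = ℚ^{m-2}`. -/
abbrev Idx1 (m : ℕ) : Type := Unit ⊕ Fin (m - 2) ⊕ Unit

/-- Index type for `V = ℚ^{m+2}`, written as `⟨e₁⟩ ⊕ V₁ ⊕ ⟨e₁'⟩`. -/
abbrev Idx (m : ℕ) : Type := Unit ⊕ Idx1 m ⊕ Unit

/-- The matrix `Q₁ = [[0,0,1],[0,Q₀,0],[1,0,0]]`. -/
def Q1mat (m : ℕ) (Q₀ : Matrix (Fin (m - 2)) (Fin (m - 2)) ℚ) :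
    Matrix (Idx1 m) (Idx1 m) ℚ := fun i j =>
  match i, j with
  | Sum.inl _, Sum.inr (Sum.inr _) => 1
  | Sum.inr (Sum.inr _), Sum.inl _ => 1
  | Sum.inr (Sum.inl a), Sum.inr (Sum.inl b) => Q₀ a b
  | _, _ => 0

/-- The matrix `Q = [[0,0,1],[0,Q₁,0],[1,0,0]]`. -/
def Qmat (m : ℕ) (Q₀ : Matrix (Fin (m - 2)) (Fin (m - 2)) ℚ) :
    Matrix (Idx m) (Idx m) ℚ := fun i j =>
  match i, j with
  | Sum.inl _, Sum.inr (Sum.inr _) => 1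
  | Sum.inr (Sum.inr _), Sum.inl _ => 1
  | Sum.inr (Sum.inl a), Sum.inr (Sum.inl b) => Q1mat m Q₀ a b
  | _, _ => 0

/-- The pairing `⟨X, Y⟩ = ᵗX Q Y` on `V = ℚ^{m+2}`. -/
def pairQ (m : ℕ) (Q₀ : Matrix (Fin (m - 2)) (Fin (m - 2)) ℚ) (X Y : Idx m → ℚ) : ℚ :=
  X ⬝ᵥ (Qmat m Q₀).mulVec Y

/-- The pairing `⟨X, Y⟩ = ᵗX Q₁ Y` on `V₁ = ℚ^m`. -/
def pairQ1 (m : ℕ) (Q₀ : Matrix (Fin (m - 2)) (Fin (m - 2)) ℚ) (X Y : Idx1 m → ℚ) : ℚ :=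
  X ⬝ᵥ (Q1mat m Q₀).mulVec Y

/-- The isotropic vector `e₁ = (1,0,…,0)ᵗ ∈ V`. -/
def e1 (m : ℕ) : Idx m → ℚ := fun i => match i with | Sum.inl _ => 1 | _ => 0

/-- The isotropic vector `e₁' = (0,…,0,1)ᵗ ∈ V`. -/
def e1' (m : ℕ) : Idx m → ℚ := fun i => match i with | Sum.inr (Sum.inr _) => 1 | _ => 0

/-- The isotropic vector `e₀ ∈ V₁`. -/
def e0 (m : ℕ) : Idx1 m → ℚ := fun i => match i with | Sum.inl _ => 1 | _ => 0

/-- The isotropic vector `e₀' ∈ V₁`. -/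
def e0' (m : ℕ) : Idx1 m → ℚ := fun i => match i with | Sum.inr (Sum.inr _) => 1 | _ => 0

/-- The embedding `V₁ ↪ V` (middle `m` coordinates). -/
def intoV (m : ℕ) (X : Idx1 m → ℚ) : Idx m → ℚ := fun i =>
  match i with | Sum.inr (Sum.inl a) => X a | _ => 0

/-- `G(ℚ) = O(Q)`, the orthogonal group of `Q`. -/
def Gset (m : ℕ) (Q₀ : Matrix (Fin (m - 2)) (Fin (m - 2)) ℚ) :
    Set (Matrix (Idx m) (Idx m) ℚ) := {g | gᵀ * Qmat m Q₀ * g = Qmat m Q₀}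

/-- `G₁(ℚ) = O(Q₁)`, the orthogonal group of `Q₁`. -/
def G1set (m : ℕ) (Q₀ : Matrix (Fin (m - 2)) (Fin (m - 2)) ℚ) :
    Set (Matrix (Idx1 m) (Idx1 m) ℚ) := {h | hᵀ * Q1mat m Q₀ * h = Q1mat m Q₀}

/-- The Levi element `m(r; h) = diag(r, h, r⁻¹)`. -/
def mElt (m : ℕ) (r : ℚ) (h : Matrix (Idx1 m) (Idx1 m) ℚ) :
    Matrix (Idx m) (Idx m) ℚ := fun i j =>
  match i, j with
  | Sum.inl _, Sum.inl _ => r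
  | Sum.inr (Sum.inl a), Sum.inr (Sum.inl b) => h a b
  | Sum.inr (Sum.inr _), Sum.inr (Sum.inr _) => r⁻¹
  | _, _ => 0

/-- The unipotent element `n(X) = [[1, -ᵗX Q₁, -Q₁[X]/2],[0, 1, X],[0, 0, 1]]`. -/
def nElt (m : ℕ) (Q₀ : Matrix (Fin (m - 2)) (Fin (m - 2)) ℚ) (X : Idx1 m → ℚ) :
    Matrix (Idx m) (Idx m) ℚ := fun i j =>
  match i, j with
  | Sum.inl _, Sum.inl _ => 1
  | Sum.inl _, Sum.inr (Sum.inl b) => -(X ᵥ* Q1mat m Q₀) b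
  | Sum.inl _, Sum.inr (Sum.inr _) => -(X ⬝ᵥ (Q1mat m Q₀).mulVec X) / 2
  | Sum.inr (Sum.inl a), Sum.inr (Sum.inl b) => if a = b then 1 else 0
  | Sum.inr (Sum.inl a), Sum.inr (Sum.inr _) => X a
  | Sum.inr (Sum.inr _), Sum.inr (Sum.inr _) => 1
  | _, _ => 0

/-- The parabolic `P(ℚ) = {m(r;h) n(X)}`, the stabilizer of the line `ℚe₁` in `G(ℚ)`. -/
def Pset (m : ℕ) (Q₀ : Matrix (Fin (m - 2)) (Fin (m - 2)) ℚ) :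
    Set (Matrix (Idx m) (Idx m) ℚ) :=
  {g | ∃ r : ℚ, r ≠ 0 ∧ ∃ h ∈ G1set m Q₀, ∃ X : Idx1 m → ℚ,
      g = mElt m r h * nElt m Q₀ X}

/-- The vector `ξ = a e₀ + α + e₀' ∈ V₁`. -/
def xiVec (m : ℕ) (a : ℚ) (α : Fin (m - 2) → ℚ) : Idx1 m → ℚ := fun i =>
  match i with
  | Sum.inl _ => a
  | Sum.inr (Sum.inl b) => α b
  | Sum.inr (Sum.inr _) => 1

/-- `ξ` viewed inside `V`. -/
def xiV (m : ℕ) (a : ℚ) (α : Fin (m - 2) → ℚ) : Idx m → ℚ := intoV m (xiVec m a α)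

/-- `P^ξ(ℚ) = {p ∈ P(ℚ) : pξ = ξ}`. -/
def Pxi (m : ℕ) (Q₀ : Matrix (Fin (m - 2)) (Fin (m - 2)) ℚ) (a : ℚ)
    (α : Fin (m - 2) → ℚ) : Set (Matrix (Idx m) (Idx m) ℚ) :=
  {p | p ∈ Pset m Q₀ ∧ p.mulVec (xiV m a α) = xiV m a α}

/-- The Weyl element `𝔴₀` : `e₁ ↦ -e₁'`, `e₁' ↦ -e₁`, identity on `V₁`. -/
def w0 (m : ℕ) : Matrix (Idx m) (Idx m) ℚ := fun i j =>
  match i, j with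
  | Sum.inr (Sum.inr _), Sum.inl _ => -1
  | Sum.inl _, Sum.inr (Sum.inr _) => -1
  | Sum.inr (Sum.inl a), Sum.inr (Sum.inl b) => if a = b then 1 else 0
  | _, _ => 0

/-- The Weyl element `𝔴₁` : `e₁ ↔ e₀`, `e₁' ↔ e₀'`, identity on `V₀`. -/
def w1 (m : ℕ) : Matrix (Idx m) (Idx m) ℚ := fun i j =>
  match i, j with
  | Sum.inr (Sum.inl (Sum.inl _)), Sum.inl _ => 1
  | Sum.inl _, Sum.inr (Sum.inl (Sum.inl _)) => 1
  | Sum.inr (Sum.inl (Sum.inr (Sum.inr _))), Sum.inr (Sum.inr _) => 1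
  | Sum.inr (Sum.inr _), Sum.inr (Sum.inl (Sum.inr (Sum.inr _))) => 1
  | Sum.inr (Sum.inl (Sum.inr (Sum.inl a))), Sum.inr (Sum.inl (Sum.inr (Sum.inl b))) =>
      if a = b then 1 else 0
  | _, _ => 0

/-- The double coset `P^ξ(ℚ) u P(ℚ)`. -/
def DCoset (m : ℕ) (Q₀ : Matrix (Fin (m - 2)) (Fin (m - 2)) ℚ) (a : ℚ)
    (α : Fin (m - 2) → ℚ) (u : Matrix (Idx m) (Idx m) ℚ) :
    Set (Matrix (Idx m) (Idx m) ℚ) :=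
  {g | ∃ p ∈ Pxi m Q₀ a α, ∃ q ∈ Pset m Q₀, g = p * u * q}

/-- Build a vector of `V` from its three blocks. -/
def bvec (m : ℕ) (x : ℚ) (Y : Idx1 m → ℚ) (z : ℚ) : Idx m → ℚ := fun i =>
  match i with
  | Sum.inl _ => x
  | Sum.inr (Sum.inl b) => Y b
  | Sum.inr (Sum.inr _) => z

/-- Build a vector of `V₁` from its three blocks. -/
def vec1 (m : ℕ) (x : ℚ) (Y : Fin (m - 2) → ℚ) (z : ℚ) : Idx1 m → ℚ := fun i =>
  match i with
  | Sum.inl _ => x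
  | Sum.inr (Sum.inl b) => Y b
  | Sum.inr (Sum.inr _) => z

section aux
variable {m : ℕ} {Q₀ : Matrix (Fin (m - 2)) (Fin (m - 2)) ℚ}

theorem vec_surj (v : Idx m → ℚ) : ∃ x Y z, v = bvec m x Y z :=
  ⟨v (Sum.inl ()), fun b => v (Sum.inr (Sum.inl b)), v (Sum.inr (Sum.inr ())), by
    funext i; rcases i with i | i | i <;> rfl⟩

theorem vec1_surj (v : Idx1 m → ℚ) : ∃ x Y z, v = vec1 m x Y z :=
  ⟨v (Sum.inl ()), fun b => v (Sum.inr (Sum.inl b)), v (Sum.inr (Sum.inr ())), by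
    funext i; rcases i with i | i | i <;> rfl⟩

theorem vec_inj {x x' z z' : ℚ} {Y Y' : Idx1 m → ℚ} (h : bvec m x Y z = bvec m x' Y' z') :
    x = x' ∧ Y = Y' ∧ z = z' :=
  ⟨congrFun h (Sum.inl ()), funext fun b => congrFun h (Sum.inr (Sum.inl b)),
    congrFun h (Sum.inr (Sum.inr ()))⟩

theorem smul_vec (c x z : ℚ) (Y : Idx1 m → ℚ) :
    c • bvec m x Y z = bvec m (c * x) (c • Y) (c * z) := by
  funext i; rcases i with i | i | i <;> rfl

theorem e1_eq : e1 m = bvec m 1 0 0 := by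
  funext i; rcases i with i | i | i <;> rfl

theorem xiV_eq (a : ℚ) (α : Fin (m - 2) → ℚ) : xiV m a α = bvec m 0 (xiVec m a α) 0 := by
  funext i; rcases i with i | i | i <;> rfl

theorem xiVec_eq (a : ℚ) (α : Fin (m - 2) → ℚ) : xiVec m a α = vec1 m a α 1 := by
  funext i; rcases i with i | i | i <;> rfl

theorem e0_eq : e0 m = vec1 m 1 0 0 := by
  funext i; rcases i with i | i | i <;> rfl

theorem pairQ1_vec (x x' z z' : ℚ) (Y Y' : Fin (m - 2) → ℚ) :
    pairQ1 m Q₀ (vec1 m x Y z) (vec1 m x' Y' z') = x * z' + z * x' + Y ⬝ᵥ Q₀ *ᵥ Y' := by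
  simp [pairQ1, dotProduct, mulVec, Q1mat, vec1, Fintype.sum_sum_type]
  ring

theorem pairQ_vec (x x' z z' : ℚ) (Y Y' : Idx1 m → ℚ) :
    pairQ m Q₀ (bvec m x Y z) (bvec m x' Y' z') = x * z' + z * x' + pairQ1 m Q₀ Y Y' := by
  have h : ∀ i : Idx m, (Qmat m Q₀ *ᵥ bvec m x' Y' z') i = bvec m z' (Q1mat m Q₀ *ᵥ Y') x' i := by
    rintro (i | i | i) <;>
      simp only [mulVec, dotProduct, Fintype.sum_sum_type (α₁ := Unit) (α₂ := Idx1 m ⊕ Unit),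
        Fintype.sum_sum_type (α₁ := Idx1 m) (α₂ := Unit)] <;>
      simp [-Fintype.sum_sum_type, Qmat, bvec, mulVec, dotProduct]
  rw [pairQ, funext h]
  simp only [dotProduct, Fintype.sum_sum_type (α₁ := Unit) (α₂ := Idx1 m ⊕ Unit),
        Fintype.sum_sum_type (α₁ := Idx1 m) (α₂ := Unit)]
  simp only [bvec, pairQ1, dotProduct, Finset.univ_unique, Finset.sum_singleton]
  ring

theorem mElt_vec (r x z : ℚ) (h : Matrix (Idx1 m) (Idx1 m) ℚ) (Y : Idx1 m → ℚ) :
    mElt m r h *ᵥ bvec m x Y z = bvec m (r * x) (h *ᵥ Y) (r⁻¹ * z) := by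
  funext i
  rcases i with i | i | i <;>
      simp only [mulVec, dotProduct, Fintype.sum_sum_type (α₁ := Unit) (α₂ := Idx1 m ⊕ Unit),
        Fintype.sum_sum_type (α₁ := Idx1 m) (α₂ := Unit)] <;>
      simp [-Fintype.sum_sum_type, mElt, bvec, mulVec, dotProduct]

theorem nElt_vec (X : Idx1 m → ℚ) (x z : ℚ) (Y : Idx1 m → ℚ) :
    nElt m Q₀ X *ᵥ bvec m x Y z =
      bvec m (x - pairQ1 m Q₀ X Y - pairQ1 m Q₀ X X / 2 * z) (Y + z • X) z := by
  funext i
  have h : ∀ W, pairQ1 m Q₀ X W = ∑ b, (X ᵥ* Q1mat m Q₀) b * W b := by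
    intro W; rw [pairQ1, dotProduct_mulVec]; rfl
  rcases i with i | i | i <;>
      simp only [mulVec, dotProduct, Fintype.sum_sum_type (α₁ := Unit) (α₂ := Idx1 m ⊕ Unit),
        Fintype.sum_sum_type (α₁ := Idx1 m) (α₂ := Unit)]
  · have h2 : X ⬝ᵥ Q1mat m Q₀ *ᵥ X = pairQ1 m Q₀ X X := rfl
    simp only [nElt, bvec, Finset.univ_unique, Finset.sum_singleton, h2]
    rw [h Y]
    simp only [neg_mul, Finset.sum_neg_distrib]
    ring
  · simp [-Fintype.sum_sum_type, nElt, bvec, mul_comm]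
  · simp [-Fintype.sum_sum_type, nElt, bvec]

theorem w0_vec (x z : ℚ) (Y : Idx1 m → ℚ) : w0 m *ᵥ bvec m x Y z = bvec m (-z) Y (-x) := by
  funext i
  rcases i with i | i | i <;>
      simp only [mulVec, dotProduct, Fintype.sum_sum_type (α₁ := Unit) (α₂ := Idx1 m ⊕ Unit),
        Fintype.sum_sum_type (α₁ := Idx1 m) (α₂ := Unit)] <;>
      simp [-Fintype.sum_sum_type, w0, bvec]

theorem w1_vec (x z y y' : ℚ) (Y : Fin (m - 2) → ℚ) :
    w1 m *ᵥ bvec m x (vec1 m y Y y') z = bvec m y (vec1 m x Y z) y' := by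
  funext i
  rcases i with i | (i | i | i) | i <;>
      simp [mulVec, dotProduct, w1, bvec, vec1]

theorem pairQ_comm (hsym : Q₀.IsSymm) (v w : Idx m → ℚ) : pairQ m Q₀ v w = pairQ m Q₀ w v := by
  have h : (Qmat m Q₀)ᵀ = Qmat m Q₀ := by
    ext i j
    have h0 : ∀ i j, Q₀ j i = Q₀ i j := fun i j => congrFun (congrFun hsym i) j
    rcases i with i | (i | i | i) | i <;> rcases j with j | (j | j | j) | j <;>
      simp [Qmat, Q1mat, h0]
  rw [pairQ, pairQ, dotProduct_comm, dotProduct_mulVec, ← mulVec_transpose, h]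

theorem pairQ1_comm (hsym : Q₀.IsSymm) (v w : Idx1 m → ℚ) :
    pairQ1 m Q₀ v w = pairQ1 m Q₀ w v := by
  have := pairQ_comm hsym (bvec m 0 v 0) (bvec m 0 w 0)
  simpa [pairQ_vec] using this

theorem pairQ1_add_left (u v w : Idx1 m → ℚ) :
    pairQ1 m Q₀ (u + v) w = pairQ1 m Q₀ u w + pairQ1 m Q₀ v w := by
  simp [pairQ1, add_dotProduct]
theorem pairQ1_add_right (u v w : Idx1 m → ℚ) :
    pairQ1 m Q₀ u (v + w) = pairQ1 m Q₀ u v + pairQ1 m Q₀ u w := by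
  simp [pairQ1, mulVec_add]
theorem pairQ1_sub_left (u v w : Idx1 m → ℚ) :
    pairQ1 m Q₀ (u - v) w = pairQ1 m Q₀ u w - pairQ1 m Q₀ v w := by
  simp [pairQ1, sub_dotProduct]
theorem pairQ1_sub_right (u v w : Idx1 m → ℚ) :
    pairQ1 m Q₀ u (v - w) = pairQ1 m Q₀ u v - pairQ1 m Q₀ u w := by
  simp [pairQ1, mulVec_sub]
theorem pairQ1_smul_left (c : ℚ) (v w : Idx1 m → ℚ) :
    pairQ1 m Q₀ (c • v) w = c * pairQ1 m Q₀ v w := by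
  simp [pairQ1]
theorem pairQ1_smul_right (c : ℚ) (v w : Idx1 m → ℚ) :
    pairQ1 m Q₀ v (c • w) = c * pairQ1 m Q₀ v w := by
  simp [pairQ1, mulVec_smul]
theorem pairQ1_zero_left (w : Idx1 m → ℚ) : pairQ1 m Q₀ 0 w = 0 := by
  simp [pairQ1]
theorem pairQ1_zero_right (w : Idx1 m → ℚ) : pairQ1 m Q₀ w 0 = 0 := by
  simp [pairQ1]
theorem pairQ_smul_left (c : ℚ) (v w : Idx m → ℚ) :
    pairQ m Q₀ (c • v) w = c * pairQ m Q₀ v w := by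
  simp [pairQ]
theorem pairQ_smul_right (c : ℚ) (v w : Idx m → ℚ) :
    pairQ m Q₀ v (c • w) = c * pairQ m Q₀ v w := by
  simp [pairQ, mulVec_smul]

theorem isom_iff {n : Type} [Fintype n] [DecidableEq n] (g A : Matrix n n ℚ) :
    gᵀ * A * g = A ↔ ∀ v w, (g *ᵥ v) ⬝ᵥ A *ᵥ (g *ᵥ w) = v ⬝ᵥ A *ᵥ w := by
  have key : ∀ v w, (g *ᵥ v) ⬝ᵥ A *ᵥ (g *ᵥ w) = v ⬝ᵥ (gᵀ * A * g) *ᵥ w := by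
    intro v w
    rw [← mulVec_mulVec, ← mulVec_mulVec, dotProduct_mulVec v, vecMul_transpose]
  constructor
  · intro h v w; rw [key, h]
  · intro h
    ext i j
    have := h (Pi.single i 1) (Pi.single j 1)
    rw [key] at this
    simpa using this

theorem mem_G_iff {g : Matrix (Idx m) (Idx m) ℚ} :
    g ∈ Gset m Q₀ ↔ ∀ v w, pairQ m Q₀ (g *ᵥ v) (g *ᵥ w) = pairQ m Q₀ v w :=
  isom_iff g _

theorem mem_G1_iff {g : Matrix (Idx1 m) (Idx1 m) ℚ} :
    g ∈ G1set m Q₀ ↔ ∀ v w, pairQ1 m Q₀ (g *ᵥ v) (g *ᵥ w) = pairQ1 m Q₀ v w :=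
  isom_iff g _

theorem mul_mem_G {g h : Matrix (Idx m) (Idx m) ℚ} (hg : g ∈ Gset m Q₀) (hh : h ∈ Gset m Q₀) :
    g * h ∈ Gset m Q₀ := by
  rw [mem_G_iff] at *
  intro v w
  rw [← mulVec_mulVec, ← mulVec_mulVec, hg, hh]

theorem nondeg1 (hpos : ∀ x : Fin (m - 2) → ℚ, x ≠ 0 → 0 < x ⬝ᵥ Q₀.mulVec x)
    (v : Idx1 m → ℚ) (h : ∀ w, pairQ1 m Q₀ v w = 0) : v = 0 := by
  obtain ⟨x, Y, z, rfl⟩ := vec1_surj v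
  have h1 := h (vec1 m 1 0 0)
  have h2 := h (vec1 m 0 0 1)
  have h3 := h (vec1 m 0 Y 0)
  simp [pairQ1_vec] at h1 h2 h3
  have : Y = 0 := by
    by_contra hY
    exact (hpos Y hY).ne' h3
  subst this h1 h2
  funext i; rcases i with i | i | i <;> rfl

theorem nondeg (hpos : ∀ x : Fin (m - 2) → ℚ, x ≠ 0 → 0 < x ⬝ᵥ Q₀.mulVec x)
    (v : Idx m → ℚ) (h : ∀ w, pairQ m Q₀ v w = 0) : v = 0 := by
  obtain ⟨x, Y, z, rfl⟩ := vec_surj v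
  have h1 := h (bvec m 1 0 0)
  have h2 := h (bvec m 0 0 1)
  have h3 : Y = 0 := nondeg1 hpos Y fun w => by
    have := h (bvec m 0 w 0)
    simpa [pairQ_vec] using this
  simp [pairQ_vec, pairQ1_zero_right] at h1 h2
  subst h1 h2 h3
  funext i; rcases i with i | i | i <;> rfl

theorem G_isUnit (hpos : ∀ x : Fin (m - 2) → ℚ, x ≠ 0 → 0 < x ⬝ᵥ Q₀.mulVec x)
    {g : Matrix (Idx m) (Idx m) ℚ} (hg : g ∈ Gset m Q₀) : IsUnit g := by
  rw [← mulVec_injective_iff_isUnit]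
  refine (injective_iff_map_eq_zero (g.mulVecLin)).2 fun v hv => nondeg hpos v fun w => ?_
  rw [mem_G_iff] at hg
  rw [← hg]
  have hv' : g *ᵥ v = 0 := hv
  simp [hv', pairQ]

theorem G1_isUnit (hpos : ∀ x : Fin (m - 2) → ℚ, x ≠ 0 → 0 < x ⬝ᵥ Q₀.mulVec x)
    {g : Matrix (Idx1 m) (Idx1 m) ℚ} (hg : g ∈ G1set m Q₀) : IsUnit g := by
  rw [← mulVec_injective_iff_isUnit]
  refine (injective_iff_map_eq_zero (g.mulVecLin)).2 fun v hv => nondeg1 hpos v fun w => ?_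
  rw [mem_G1_iff] at hg
  rw [← hg]
  have hv' : g *ᵥ v = 0 := hv
  simp [hv', pairQ1]

theorem mElt_mem {r : ℚ} (hr : r ≠ 0) {h : Matrix (Idx1 m) (Idx1 m) ℚ} (hh : h ∈ G1set m Q₀) :
    mElt m r h ∈ Gset m Q₀ := by
  rw [mem_G_iff]
  rw [mem_G1_iff] at hh
  intro v w
  obtain ⟨x, Y, z, rfl⟩ := vec_surj v
  obtain ⟨x', Y', z', rfl⟩ := vec_surj w
  simp only [mElt_vec, pairQ_vec, hh]
  field_simp

theorem nElt_mem (hsym : Q₀.IsSymm) (X : Idx1 m → ℚ) : nElt m Q₀ X ∈ Gset m Q₀ := by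
  rw [mem_G_iff]
  intro v w
  obtain ⟨x, Y, z, rfl⟩ := vec_surj v
  obtain ⟨x', Y', z', rfl⟩ := vec_surj w
  simp only [nElt_vec, pairQ_vec, pairQ1_add_left, pairQ1_add_right, pairQ1_smul_left,
    pairQ1_smul_right, pairQ1_comm hsym Y X]
  ring

theorem w0_mem : w0 m ∈ Gset m Q₀ := by
  rw [mem_G_iff]
  intro v w
  obtain ⟨x, Y, z, rfl⟩ := vec_surj v
  obtain ⟨x', Y', z', rfl⟩ := vec_surj w
  simp only [w0_vec, pairQ_vec]
  ring

theorem w1_mem : w1 m ∈ Gset m Q₀ := by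
  rw [mem_G_iff]
  intro v w
  obtain ⟨x, Y, z, rfl⟩ := vec_surj v
  obtain ⟨x', Y', z', rfl⟩ := vec_surj w
  obtain ⟨y, Y, t, rfl⟩ := vec1_surj Y
  obtain ⟨y', Y', t', rfl⟩ := vec1_surj Y'
  simp only [w1_vec, pairQ_vec, pairQ1_vec]
  ring

theorem P_sub_G (hsym : Q₀.IsSymm) {p : Matrix (Idx m) (Idx m) ℚ} (hp : p ∈ Pset m Q₀) :
    p ∈ Gset m Q₀ := by
  obtain ⟨r, hr, h, hh, X, rfl⟩ := hp
  exact mul_mem_G (mElt_mem hr hh) (nElt_mem hsym X)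

theorem mn_vec (r x z : ℚ) (h : Matrix (Idx1 m) (Idx1 m) ℚ) (X Y : Idx1 m → ℚ) :
    (mElt m r h * nElt m Q₀ X) *ᵥ bvec m x Y z =
      bvec m (r * (x - pairQ1 m Q₀ X Y - pairQ1 m Q₀ X X / 2 * z)) (h *ᵥ (Y + z • X))
        (r⁻¹ * z) := by
  rw [← mulVec_mulVec, nElt_vec, mElt_vec]

theorem P_e1 {p : Matrix (Idx m) (Idx m) ℚ} (hp : p ∈ Pset m Q₀) :
    ∃ r : ℚ, r ≠ 0 ∧ p *ᵥ e1 m = r • e1 m := by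
  obtain ⟨r, hr, h, hh, X, rfl⟩ := hp
  refine ⟨r, hr, ?_⟩
  rw [e1_eq, mn_vec, smul_vec]
  simp [pairQ1_zero_right]

theorem mem_P (hsym : Q₀.IsSymm)
    (hpos : ∀ x : Fin (m - 2) → ℚ, x ≠ 0 → 0 < x ⬝ᵥ Q₀.mulVec x)
    {g : Matrix (Idx m) (Idx m) ℚ} (hg : g ∈ Gset m Q₀) (r : ℚ) (h1 : g *ᵥ e1 m = r • e1 m) :
    g ∈ Pset m Q₀ := by
  rw [e1_eq, smul_vec] at h1
  simp only [mul_one, mul_zero, smul_zero] at h1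
  have hG := mem_G_iff.1 hg
  let h : Matrix (Idx1 m) (Idx1 m) ℚ := fun i j => g (Sum.inr (Sum.inl i)) (Sum.inr (Sum.inl j))
  obtain ⟨x, Y, z, h2⟩ := vec_surj (g *ᵥ bvec m 0 0 1)
  have hrz : r * z = 1 := by
    have := hG (bvec m 1 0 0) (bvec m 0 0 1)
    rw [h1, h2] at this
    simpa [pairQ_vec, pairQ1_zero_left] using this
  have hr : r ≠ 0 := left_ne_zero_of_mul_eq_one hrz
  have hz : z = r⁻¹ := eq_inv_of_mul_eq_one_right hrz
  have h3 : ∀ W, ∃ l, g *ᵥ bvec m 0 W 0 = bvec m l (h *ᵥ W) 0 := by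
    intro W
    obtain ⟨l, U, t, h4⟩ := vec_surj (g *ᵥ bvec m 0 W 0)
    have ht : t = 0 := by
      have := hG (bvec m 1 0 0) (bvec m 0 W 0)
      rw [h1, h4] at this
      simpa [pairQ_vec, pairQ1_zero_left, hr] using this
    have hU : U = h *ᵥ W := by
      funext b
      have := congrFun h4 (Sum.inr (Sum.inl b))
      rw [show bvec m l U t (Sum.inr (Sum.inl b)) = U b from rfl] at this
      rw [← this]
      simp only [mulVec, dotProduct,
        Fintype.sum_sum_type (α₁ := Unit) (α₂ := Idx1 m ⊕ Unit),
        Fintype.sum_sum_type (α₁ := Idx1 m) (α₂ := Unit)]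
      simp [-Fintype.sum_sum_type, bvec, h]
    exact ⟨l, by rw [h4, ht, hU]⟩
  have hh : h ∈ G1set m Q₀ := by
    rw [mem_G1_iff]
    intro v w
    obtain ⟨l, hl⟩ := h3 v
    obtain ⟨l', hl'⟩ := h3 w
    have := hG (bvec m 0 v 0) (bvec m 0 w 0)
    rw [hl, hl'] at this
    simpa [pairQ_vec] using this
  obtain ⟨X, hX⟩ := mulVec_surjective_iff_isUnit.2 (G1_isUnit hpos hh) Y
  have hX : h *ᵥ X = Y := hX
  refine ⟨r, hr, h, hh, X, ?_⟩
  have hG1 := mem_G1_iff.1 hh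
  have hx : 2 * x * z + pairQ1 m Q₀ X X = 0 := by
    have := hG (bvec m 0 0 1) (bvec m 0 0 1)
    rw [h2, ← hX] at this
    simp only [pairQ_vec, pairQ1_zero_left, hG1] at this
    linarith
  have hl : ∀ W l, g *ᵥ bvec m 0 W 0 = bvec m l (h *ᵥ W) 0 → l * z + pairQ1 m Q₀ X W = 0 := by
    intro W l hl
    have := hG (bvec m 0 0 1) (bvec m 0 W 0)
    rw [h2, ← hX, hl] at this
    simp only [pairQ_vec, pairQ1_zero_left, hG1] at this
    linarith
  apply Matrix.ext_of_mulVec_single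
  intro i
  generalize (Pi.single i 1 : Idx m → ℚ) = v
  obtain ⟨y, W, t, rfl⟩ := vec_surj v
  have hd : bvec m y W t = y • bvec m 1 0 0 + bvec m 0 W 0 + t • bvec m 0 0 1 := by
    funext i; rcases i with i | i | i <;> simp [bvec]
  obtain ⟨l, h4⟩ := h3 W
  have h5 := hl W l h4
  rw [mn_vec, hd, mulVec_add, mulVec_add, mulVec_smul, mulVec_smul, h1, h2, h4, ← hX]
  have e1 : l = - r * pairQ1 m Q₀ X W := by
    rw [hz] at h5; field_simp at h5; linarith
  have e2 : x = - r * pairQ1 m Q₀ X X / 2 := by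
    rw [hz] at hx; field_simp at hx; linarith
  funext i
  rcases i with i | i | i
  · simp [bvec, e1, e2]; ring
  · simp [bvec, mulVec_add, mulVec_smul]
  · simp [bvec, hz, mul_comm]

theorem inv_mem_G (hpos : ∀ x : Fin (m - 2) → ℚ, x ≠ 0 → 0 < x ⬝ᵥ Q₀.mulVec x)
    {g : Matrix (Idx m) (Idx m) ℚ} (hg : g ∈ Gset m Q₀) :
    ∃ k ∈ Gset m Q₀, k * g = 1 ∧ g * k = 1 := by
  obtain ⟨u, rfl⟩ := G_isUnit hpos hg
  refine ⟨(u⁻¹ : (Matrix (Idx m) (Idx m) ℚ)ˣ), ?_, u.inv_mul, u.mul_inv⟩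
  rw [mem_G_iff] at *
  intro v w
  rw [← hg]
  simp only [mulVec_mulVec, u.mul_inv, one_mulVec]

theorem mem_DCoset (hsym : Q₀.IsSymm)
    (hpos : ∀ x : Fin (m - 2) → ℚ, x ≠ 0 → 0 < x ⬝ᵥ Q₀.mulVec x)
    {a : ℚ} {α : Fin (m - 2) → ℚ} {g u p : Matrix (Idx m) (Idx m) ℚ} (hg : g ∈ Gset m Q₀)
    (hu : u ∈ Gset m Q₀) (hp : p ∈ Pxi m Q₀ a α) (c : ℚ)
    (h : g *ᵥ e1 m = c • p *ᵥ (u *ᵥ e1 m)) : g ∈ DCoset m Q₀ a α u := by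
  obtain ⟨k, hk, h1, h2⟩ := inv_mem_G hpos (mul_mem_G (P_sub_G hsym hp.1) hu)
  refine ⟨p, hp, k * g, mem_P hsym hpos (mul_mem_G hk hg) c ?_, ?_⟩
  · rw [← mulVec_mulVec, h, mulVec_smul, mulVec_mulVec, mulVec_mulVec, mul_assoc, h1, one_mulVec]
  · rw [← mul_assoc, h2, one_mul]

theorem DCoset_prop (hsym : Q₀.IsSymm)
    {a : ℚ} {α : Fin (m - 2) → ℚ} {g u : Matrix (Idx m) (Idx m) ℚ}
    (h : g ∈ DCoset m Q₀ a α u) :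
    (pairQ m Q₀ (g *ᵥ e1 m) (xiV m a α) = 0 ↔ pairQ m Q₀ (u *ᵥ e1 m) (xiV m a α) = 0) ∧
    (pairQ m Q₀ (g *ᵥ e1 m) (e1 m) = 0 ↔ pairQ m Q₀ (u *ᵥ e1 m) (e1 m) = 0) := by
  obtain ⟨p, hp, q, hq, rfl⟩ := h
  have hpG := mem_G_iff.1 (P_sub_G hsym hp.1)
  obtain ⟨c, hc, hqe⟩ := P_e1 hq
  obtain ⟨r, hr, hpe⟩ := P_e1 hp.1
  rw [← mulVec_mulVec, hqe, mulVec_smul, ← mulVec_mulVec]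
  constructor
  · conv_lhs => rw [← hp.2, pairQ_smul_left, hpG]
    simp [hc]
  · have : pairQ m Q₀ (u *ᵥ e1 m) (e1 m) = r * pairQ m Q₀ (p *ᵥ (u *ᵥ e1 m)) (e1 m) := by
      rw [← hpG, hpe, pairQ_smul_right]
    rw [this, pairQ_smul_left]
    simp [hc, hr]

theorem DCoset_sub_G (hsym : Q₀.IsSymm)
    {a : ℚ} {α : Fin (m - 2) → ℚ} {g u : Matrix (Idx m) (Idx m) ℚ} (hu : u ∈ Gset m Q₀)
    (h : g ∈ DCoset m Q₀ a α u) : g ∈ Gset m Q₀ := by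
  obtain ⟨p, hp, q, hq, rfl⟩ := h
  exact mul_mem_G (mul_mem_G (P_sub_G hsym hp.1) hu) (P_sub_G hsym hq)

theorem perp_pos (hsym : Q₀.IsSymm)
    (hpos : ∀ x : Fin (m - 2) → ℚ, x ≠ 0 → 0 < x ⬝ᵥ Q₀.mulVec x)
    {a : ℚ} {α : Fin (m - 2) → ℚ}
    (hξ : pairQ1 m Q₀ (xiVec m a α) (xiVec m a α) < 0) (D : Idx1 m → ℚ)
    (hD : pairQ1 m Q₀ D (xiVec m a α) = 0) (h0 : pairQ1 m Q₀ D D ≤ 0) : D = 0 := by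
  obtain ⟨d, β, t, rfl⟩ := vec1_surj D
  rw [xiVec_eq, pairQ1_vec] at *
  have hc : α ⬝ᵥ Q₀ *ᵥ β = β ⬝ᵥ Q₀ *ᵥ α := by
    have := pairQ1_comm hsym (vec1 m 0 α 0) (vec1 m 0 β 0)
    simpa [pairQ1_vec] using this
  have hexp : (β - t • α) ⬝ᵥ Q₀ *ᵥ (β - t • α) =
      β ⬝ᵥ Q₀ *ᵥ β - 2 * t * (β ⬝ᵥ Q₀ *ᵥ α) + t ^ 2 * (α ⬝ᵥ Q₀ *ᵥ α) := by
    simp only [sub_dotProduct, mulVec_sub, mulVec_smul, dotProduct_sub, smul_dotProduct,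
      dotProduct_smul, smul_eq_mul, hc]
    ring
  have hnn : ∀ x : Fin (m - 2) → ℚ, 0 ≤ x ⬝ᵥ Q₀.mulVec x := by
    intro x
    by_cases hx : x = 0
    · simp [hx]
    · exact (hpos x hx).le
  have hd : d = - (β ⬝ᵥ Q₀ *ᵥ α) - a * t := by linarith
  have h5 := hnn (β - t • α)
  have ht : t = 0 := by
    by_contra ht
    have ht2 : 0 < t ^ 2 := by positivity
    rw [hexp] at h5
    rw [hd] at h0
    nlinarith [mul_pos ht2 (neg_pos.2 hξ)]
  subst ht
  have hβ : β = 0 := by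
    by_contra hb
    have := hpos β hb
    linarith
  subst hβ
  simp at hd
  subst hd
  funext i; rcases i with i | i | i <;> rfl

theorem one_mem_G1 : (1 : Matrix (Idx1 m) (Idx1 m) ℚ) ∈ G1set m Q₀ := by
  simp [G1set]

theorem mem_Pxi {a : ℚ} {α : Fin (m - 2) → ℚ} {r : ℚ} (hr : r ≠ 0)
    {h : Matrix (Idx1 m) (Idx1 m) ℚ} (hh : h ∈ G1set m Q₀)
    (hhx : h *ᵥ xiVec m a α = xiVec m a α) {X : Idx1 m → ℚ}
    (hX : pairQ1 m Q₀ X (xiVec m a α) = 0) :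
    mElt m r h * nElt m Q₀ X ∈ Pxi m Q₀ a α := by
  refine ⟨⟨r, hr, h, hh, X, rfl⟩, ?_⟩
  rw [xiV_eq, mn_vec]
  simp [hX, hhx]

/-- Transitivity on isotropic vectors with fixed pairing against `ξ`. -/
theorem exists_h (hsym : Q₀.IsSymm)
    (hpos : ∀ x : Fin (m - 2) → ℚ, x ≠ 0 → 0 < x ⬝ᵥ Q₀.mulVec x)
    {a : ℚ} {α : Fin (m - 2) → ℚ}
    (hξ : pairQ1 m Q₀ (xiVec m a α) (xiVec m a α) < 0) (Y E : Idx1 m → ℚ)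
    (hE : pairQ1 m Q₀ E E = 0) (hY : pairQ1 m Q₀ Y Y = 0)
    (hYE : pairQ1 m Q₀ Y (xiVec m a α) = pairQ1 m Q₀ E (xiVec m a α)) :
    ∃ h ∈ G1set m Q₀, h *ᵥ xiVec m a α = xiVec m a α ∧ h *ᵥ E = Y := by
  by_cases hD : Y - E = 0
  · exact ⟨1, one_mem_G1, by simp, by simp [sub_eq_zero.1 hD]⟩
  have hDx : pairQ1 m Q₀ (Y - E) (xiVec m a α) = 0 := by
    rw [pairQ1_sub_left, hYE, sub_self]
  have hDD : pairQ1 m Q₀ (Y - E) (Y - E) ≠ 0 := fun h =>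
    hD (perp_pos hsym hpos hξ _ hDx h.le)
  have hDE : 2 * pairQ1 m Q₀ (Y - E) E = - pairQ1 m Q₀ (Y - E) (Y - E) := by
    simp only [pairQ1_sub_left, pairQ1_sub_right, hE, hY, pairQ1_comm hsym E Y]
    ring
  have hDYE : E + (Y - E) = Y := by abel
  generalize Y - E = D at *
  let h : Matrix (Idx1 m) (Idx1 m) ℚ :=
    1 - (2 / pairQ1 m Q₀ D D) • vecMulVec D (D ᵥ* Q1mat m Q₀)
  have hW : ∀ W, h *ᵥ W = W - (2 / pairQ1 m Q₀ D D * pairQ1 m Q₀ D W) • D := by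
    intro W
    have : pairQ1 m Q₀ D W = (D ᵥ* Q1mat m Q₀) ⬝ᵥ W := dotProduct_mulVec _ _ _
    rw [this]
    funext i
    simp only [h, sub_mulVec, one_mulVec, smul_mulVec, vecMulVec_mulVec, Pi.sub_apply,
      Pi.smul_apply, smul_eq_mul, MulOpposite.smul_eq_mul_unop, MulOpposite.unop_op]
    ring
  refine ⟨h, ?_, ?_, ?_⟩
  · rw [mem_G1_iff]
    intro v w
    rw [hW, hW]
    simp only [pairQ1_sub_left, pairQ1_sub_right, pairQ1_smul_left, pairQ1_smul_right,
      pairQ1_comm hsym v D]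
    field_simp
    ring
  · rw [hW, hDx]; simp
  · rw [hW, div_mul_eq_mul_div, hDE, neg_div, div_self hDD]
    simp [hDYE]

theorem w1_e1 : w1 m *ᵥ e1 m = bvec m 0 (e0 m) 0 := by
  have h0 : (0 : Idx1 m → ℚ) = vec1 m 0 0 0 := by
    funext i; rcases i with i | i | i <;> rfl
  rw [e1_eq, h0, w1_vec, e0_eq]

theorem w0_e1 : w0 m *ᵥ e1 m = bvec m 0 0 (-1) := by
  rw [e1_eq, w0_vec, neg_zero]

theorem e0_xi (a : ℚ) (α : Fin (m - 2) → ℚ) : pairQ1 m Q₀ (e0 m) (xiVec m a α) = 1 := by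
  rw [e0_eq, xiVec_eq, pairQ1_vec]; simp

theorem e0_e0 : pairQ1 m Q₀ (e0 m) (e0 m) = 0 := by
  rw [e0_eq, pairQ1_vec]; simp

theorem char_all (hsym : Q₀.IsSymm)
    (hpos : ∀ x : Fin (m - 2) → ℚ, x ≠ 0 → 0 < x ⬝ᵥ Q₀.mulVec x)
    {a : ℚ} {α : Fin (m - 2) → ℚ}
    (hξ : pairQ1 m Q₀ (xiVec m a α) (xiVec m a α) < 0)
    (g : Matrix (Idx m) (Idx m) ℚ) (hg : g ∈ Gset m Q₀) :
      (g ∈ Pset m Q₀ ↔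
        pairQ m Q₀ (g.mulVec (e1 m)) (xiV m a α) = 0 ∧
        pairQ m Q₀ (g.mulVec (e1 m)) (e1 m) = 0) ∧
      (g ∈ DCoset m Q₀ a α (w0 m) ↔
        pairQ m Q₀ (g.mulVec (e1 m)) (xiV m a α) = 0 ∧
        pairQ m Q₀ (g.mulVec (e1 m)) (e1 m) ≠ 0) ∧
      (g ∈ DCoset m Q₀ a α (w1 m) ↔
        pairQ m Q₀ (g.mulVec (e1 m)) (xiV m a α) ≠ 0 ∧
        pairQ m Q₀ (g.mulVec (e1 m)) (e1 m) = 0) ∧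
      (g ∈ DCoset m Q₀ a α (nElt m Q₀ (xiVec m a α) * w0 m) ↔
        pairQ m Q₀ (g.mulVec (e1 m)) (xiV m a α) ≠ 0 ∧
        pairQ m Q₀ (g.mulVec (e1 m)) (e1 m) ≠ 0) := by
  have hq := hξ.ne
  have hp := fun v hv => perp_pos hsym hpos hξ v hv
  have hex := exists_h hsym hpos hξ
  have hiso : pairQ m Q₀ (g *ᵥ e1 m) (g *ᵥ e1 m) = 0 := by
    rw [mem_G_iff.1 hg, e1_eq, pairQ_vec]; simp [pairQ1_zero_left]
  obtain ⟨x, Y, z, hv⟩ := vec_surj (g *ᵥ e1 m)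
  have hz : pairQ m Q₀ (g *ᵥ e1 m) (e1 m) = z := by
    rw [hv, e1_eq, pairQ_vec]; simp [pairQ1_zero_right]
  have hY : pairQ m Q₀ (g *ᵥ e1 m) (xiV m a α) = pairQ1 m Q₀ Y (xiVec m a α) := by
    rw [hv, xiV_eq, pairQ_vec]; simp
  rw [hv, pairQ_vec] at hiso
  have hn0 : nElt m Q₀ (xiVec m a α) * w0 m ∈ Gset m Q₀ := mul_mem_G (nElt_mem hsym _) w0_mem
  have hnw : (nElt m Q₀ (xiVec m a α) * w0 m) *ᵥ e1 m =
      bvec m (pairQ1 m Q₀ (xiVec m a α) (xiVec m a α) / 2) (-xiVec m a α) (-1) := by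
    rw [← mulVec_mulVec, w0_e1, nElt_vec, pairQ1_zero_right]
    simp
  have hxe := e0_xi (Q₀ := Q₀) a α
  refine ⟨⟨?_, ?_⟩, ⟨?_, ?_⟩, ⟨?_, ?_⟩, ⟨?_, ?_⟩⟩
  · intro h
    obtain ⟨r, hr, h1⟩ := P_e1 h
    rw [h1, pairQ_smul_left, pairQ_smul_left, xiV_eq, e1_eq, pairQ_vec, pairQ_vec]
    simp [pairQ1_zero_left]
  · rw [hz, hY]
    rintro ⟨h1, h2⟩
    subst h2
    have := hp Y h1 (by linarith)
    subst this
    refine mem_P hsym hpos hg x ?_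
    rw [hv, e1_eq, smul_vec]; simp
  · intro h
    obtain ⟨h1, h2⟩ := DCoset_prop hsym h
    rw [h1, Ne, h2, w0_e1, xiV_eq, e1_eq, pairQ_vec, pairQ_vec]
    simp [pairQ1_zero_left]
  · rw [hz, hY]
    rintro ⟨h1, h2⟩
    refine mem_DCoset hsym hpos hg w0_mem (mem_Pxi one_ne_zero one_mem_G1 (by simp)
      (X := z⁻¹ • Y) (by rw [pairQ1_smul_left, h1, mul_zero])) (-z) ?_
    have hx : x = - pairQ1 m Q₀ Y Y / (2 * z) := by
      field_simp; linarith
    rw [hv, w0_e1, mn_vec, smul_vec, pairQ1_zero_right, pairQ1_smul_left, pairQ1_smul_right, hx]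
    congr 1
    · field_simp; ring
    · funext i; simp [smul_smul, h2]
    · simp
  · intro h
    obtain ⟨h1, h2⟩ := DCoset_prop hsym h
    rw [Ne, h1, h2, w1_e1, xiV_eq, e1_eq, pairQ_vec, pairQ_vec]
    simp [pairQ1_zero_right, hxe]
  · rw [hz, hY]
    rintro ⟨h1, h2⟩
    subst h2
    have hYY : pairQ1 m Q₀ Y Y = 0 := by linarith
    obtain ⟨h, hh, hhx, hhe⟩ := hex ((pairQ1 m Q₀ Y (xiVec m a α))⁻¹ • Y) (e0 m) e0_e0
      (by rw [pairQ1_smul_left, pairQ1_smul_right, hYY]; simp)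
      (by rw [pairQ1_smul_left, inv_mul_cancel₀ h1, hxe])
    generalize hc : pairQ1 m Q₀ Y (xiVec m a α) = c at *
    generalize hk : pairQ1 m Q₀ (xiVec m a α) (xiVec m a α) = k at *
    refine mem_DCoset hsym hpos hg w1_mem (mem_Pxi one_ne_zero hh hhx
      (X := (x * k / c) • (e0 m - k⁻¹ • xiVec m a α)) ?_) c ?_
    · rw [pairQ1_smul_left, pairQ1_sub_left, pairQ1_smul_left, hk, hxe, inv_mul_cancel₀ hq]
      simp
    · rw [hv, w1_e1, mn_vec, smul_vec, pairQ1_smul_left, pairQ1_sub_left, pairQ1_smul_left,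
        e0_e0, pairQ1_comm hsym (xiVec m a α), hxe]
      congr 1
      · field_simp; ring
      · simp [hhe, smul_smul, h1]
      · simp
  · intro h
    obtain ⟨h1, h2⟩ := DCoset_prop hsym h
    rw [Ne, Ne, h1, h2, hnw, xiV_eq, e1_eq, pairQ_vec, pairQ_vec,
      ← neg_one_smul ℚ (xiVec m a α), pairQ1_smul_left]
    simp [pairQ1_zero_right, hq]
  · rw [hz, hY]
    rintro ⟨h1, h2⟩
    have hx : x = - pairQ1 m Q₀ Y Y / (2 * z) := by
      field_simp; linarith
    generalize hc : pairQ1 m Q₀ Y (xiVec m a α) = c at *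
    generalize hk : pairQ1 m Q₀ (xiVec m a α) (xiVec m a α) = k at *
    refine mem_DCoset hsym hpos hg hn0 (mem_Pxi (r := c / k / z)
      (div_ne_zero (div_ne_zero h1 hq) h2) one_mem_G1 (by simp)
      (X := (k / c) • Y - xiVec m a α) ?_) (-(c / k)) ?_
    · rw [pairQ1_sub_left, pairQ1_smul_left, hc, hk]; field_simp; ring
    · rw [hv, hnw, mn_vec, smul_vec, ← neg_one_smul ℚ (xiVec m a α)]
      simp only [pairQ1_sub_left, pairQ1_smul_left, pairQ1_sub_right, pairQ1_smul_right,
        pairQ1_comm hsym (xiVec m a α) Y, hc, hk, hx]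
      congr 1
      · field_simp; ring
      · funext i
        simp
        field_simp
        ring
      · field_simp

end aux

/-- `G(ℚ)` is the disjoint union of the four double cosets `P(ℚ)`,
`P^ξ(ℚ)𝔴₁P(ℚ)`, `P^ξ(ℚ)𝔴₀P(ℚ)`, `P^ξ(ℚ)n(ξ)𝔴₀P(ℚ)`, and membership in each is
characterized by the (non)vanishing of `⟨g e₁, ξ⟩` and `⟨g e₁, e₁⟩`. -/
theorem stmt2 (m : ℕ) (hm : 3 ≤ m)
    (Q₀ : Matrix (Fin (m - 2)) (Fin (m - 2)) ℚ) (hsym : Q₀.IsSymm)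
    (hpos : ∀ x : Fin (m - 2) → ℚ, x ≠ 0 → 0 < x ⬝ᵥ Q₀.mulVec x)
    (a : ℚ) (α : Fin (m - 2) → ℚ)
    (hξ : pairQ1 m Q₀ (xiVec m a α) (xiVec m a α) < 0) :
    (∀ g ∈ Gset m Q₀,
      (g ∈ Pset m Q₀ ↔
        pairQ m Q₀ (g.mulVec (e1 m)) (xiV m a α) = 0 ∧
        pairQ m Q₀ (g.mulVec (e1 m)) (e1 m) = 0) ∧
      (g ∈ DCoset m Q₀ a α (w0 m) ↔
        pairQ m Q₀ (g.mulVec (e1 m)) (xiV m a α) = 0 ∧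
        pairQ m Q₀ (g.mulVec (e1 m)) (e1 m) ≠ 0) ∧
      (g ∈ DCoset m Q₀ a α (w1 m) ↔
        pairQ m Q₀ (g.mulVec (e1 m)) (xiV m a α) ≠ 0 ∧
        pairQ m Q₀ (g.mulVec (e1 m)) (e1 m) = 0) ∧
      (g ∈ DCoset m Q₀ a α (nElt m Q₀ (xiVec m a α) * w0 m) ↔
        pairQ m Q₀ (g.mulVec (e1 m)) (xiV m a α) ≠ 0 ∧
        pairQ m Q₀ (g.mulVec (e1 m)) (e1 m) ≠ 0)) ∧
    Gset m Q₀ = Pset m Q₀ ∪ DCoset m Q₀ a α (w1 m) ∪ DCoset m Q₀ a α (w0 m) ∪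
        DCoset m Q₀ a α (nElt m Q₀ (xiVec m a α) * w0 m) ∧
    Pset m Q₀ ∩ DCoset m Q₀ a α (w1 m) = ∅ ∧
    Pset m Q₀ ∩ DCoset m Q₀ a α (w0 m) = ∅ ∧
    Pset m Q₀ ∩ DCoset m Q₀ a α (nElt m Q₀ (xiVec m a α) * w0 m) = ∅ ∧
    DCoset m Q₀ a α (w1 m) ∩ DCoset m Q₀ a α (w0 m) = ∅ ∧
    DCoset m Q₀ a α (w1 m) ∩ DCoset m Q₀ a α (nElt m Q₀ (xiVec m a α) * w0 m) = ∅ ∧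
    DCoset m Q₀ a α (w0 m) ∩ DCoset m Q₀ a α (nElt m Q₀ (xiVec m a α) * w0 m) = ∅ := by
  have H := char_all hsym hpos hξ
  have hn0 : nElt m Q₀ (xiVec m a α) * w0 m ∈ Gset m Q₀ := mul_mem_G (nElt_mem hsym _) w0_mem
  have hP : ∀ g ∈ Pset m Q₀, g ∈ Gset m Q₀ := fun g hg => P_sub_G hsym hg
  have h0 : ∀ g ∈ DCoset m Q₀ a α (w0 m), g ∈ Gset m Q₀ := fun g hg =>
    DCoset_sub_G hsym w0_mem hg
  have h1 : ∀ g ∈ DCoset m Q₀ a α (w1 m), g ∈ Gset m Q₀ := fun g hg =>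
    DCoset_sub_G hsym w1_mem hg
  have h2 : ∀ g ∈ DCoset m Q₀ a α (nElt m Q₀ (xiVec m a α) * w0 m), g ∈ Gset m Q₀ :=
    fun g hg => DCoset_sub_G hsym hn0 hg
  refine ⟨H, ?_, ?_, ?_, ?_, ?_, ?_, ?_⟩
  · ext g
    simp only [Set.mem_union]
    constructor
    · intro hg
      obtain ⟨H1, H2, H3, H4⟩ := H g hg
      rw [H1, H2, H3, H4]
      clear H hP h0 h1 h2 H1 H2 H3 H4
      tauto
    · rintro (((h | h) | h) | h)
      · exact hP g h
      · exact h1 g h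
      · exact h0 g h
      · exact h2 g h
  all_goals
    refine Set.eq_empty_iff_forall_notMem.2 ?_
    rintro g ⟨ha, hb⟩
  · obtain ⟨H1, H2, H3, H4⟩ := H g (hP g ha)
    clear H hP h0 h1 h2
    have A := H1.1 ha
    have B := H3.1 hb
    tauto
  · obtain ⟨H1, H2, H3, H4⟩ := H g (hP g ha)
    clear H hP h0 h1 h2
    have A := H1.1 ha
    have B := H2.1 hb
    tauto
  · obtain ⟨H1, H2, H3, H4⟩ := H g (hP g ha)
    clear H hP h0 h1 h2
    have A := H1.1 ha
    have B := H4.1 hb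
    tauto
  · obtain ⟨H1, H2, H3, H4⟩ := H g (h1 g ha)
    clear H hP h0 h1 h2
    have A := H3.1 ha
    have B := H2.1 hb
    tauto
  · obtain ⟨H1, H2, H3, H4⟩ := H g (h1 g ha)
    clear H hP h0 h1 h2
    have A := H3.1 ha
    have B := H4.1 hb
    tauto
  · obtain ⟨H1, H2, H3, H4⟩ := H g (h0 g ha)
    clear H hP h0 h1 h2
    have A := H2.1 ha
    have B := H4.1 hb
    tauto
end

section
/- (1) For every δ ∈ G₁(ℚ) and Z ∈ V₁, the element m(1;δ) n(Z) m(1;δ)⁻¹ belongs to P^ξ(ℚ) if and only if ⟨δZ, ξ⟩ = 0; equivalently, N(ℚ) ∩ m(1;δ)⁻¹ P^ξ(ℚ) m(1;δ) = {n(Z) : Z ∈ V₁, ⟨Z, δ⁻¹ξ⟩ = 0}. (2) If γ = u · m(t;δ) with u ∈ {𝔴₁, 𝔴₀, n(ξ)𝔴₀}, t ∈ ℚ^×, δ ∈ G₁(ℚ), then N(ℚ) ∩ γ⁻¹ P^ξ(ℚ) γ = {1}; that is, for X ∈ V₁, γ n(X) γ⁻¹ ∈ P^ξ(ℚ) implies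 X = 0. -/
open Matrix

lemma aux_sum (m : ℕ) (f : Idx m → ℚ) :
    ∑ i, f i = f (Sum.inl ()) + ((∑ c, f (Sum.inr (Sum.inl c))) + f (Sum.inr (Sum.inr ()))) := by
  have h : ∑ d : Idx1 m ⊕ Unit, f (Sum.inr d) =
      (∑ c, f (Sum.inr (Sum.inl c))) + f (Sum.inr (Sum.inr ())) := by
    rw [Fintype.sum_sum_type (α₁ := Idx1 m)]
    congr 1
    exact Fintype.sum_unique _
  rw [Fintype.sum_sum_type, h]
  congr 1
  exact Fintype.sum_unique _

lemma aux_Q1_inj (m : ℕ) (Q₀ : Matrix (Fin (m - 2)) (Fin (m - 2)) ℚ)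
    (hpos : ∀ x : Fin (m - 2) → ℚ, x ≠ 0 → 0 < x ⬝ᵥ Q₀.mulVec x)
    (v : Idx1 m → ℚ) (hv : (Q1mat m Q₀).mulVec v = 0) : v = 0 := by
  have h1 : v (Sum.inr (Sum.inr ())) = 0 := by
    have := congrFun hv (Sum.inl ())
    simpa [Matrix.mulVec, dotProduct, Fintype.sum_sum_type, Q1mat] using this
  have h2 : v (Sum.inl ()) = 0 := by
    have := congrFun hv (Sum.inr (Sum.inr ()))
    simpa [Matrix.mulVec, dotProduct, Fintype.sum_sum_type, Q1mat] using this
  have h3 : (fun b => v (Sum.inr (Sum.inl b))) = 0 := by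
    by_contra hne
    have h := hpos _ hne
    have h0 : Q₀.mulVec (fun b => v (Sum.inr (Sum.inl b))) = 0 := by
      funext c
      have := congrFun hv (Sum.inr (Sum.inl c))
      simpa [Matrix.mulVec, dotProduct, Fintype.sum_sum_type, Q1mat] using this
    rw [h0] at h
    simp at h
  funext i
  rcases i with _ | b | _
  · exact h2
  · exact congrFun h3 b
  · exact h1

lemma aux_delta_unit (m : ℕ) (Q₀ : Matrix (Fin (m - 2)) (Fin (m - 2)) ℚ)
    (hpos : ∀ x : Fin (m - 2) → ℚ, x ≠ 0 → 0 < x ⬝ᵥ Q₀.mulVec x)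
    (δ : Matrix (Idx1 m) (Idx1 m) ℚ) (hδ : δ ∈ G1set m Q₀) : IsUnit δ := by
  rw [← Matrix.mulVec_injective_iff_isUnit]
  intro x y hxy
  have hxy' : δ.mulVec (x - y) = 0 := by
    rw [Matrix.mulVec_sub]; exact sub_eq_zero.mpr hxy
  have : (Q1mat m Q₀).mulVec (x - y) = 0 := by
    have hd : δᵀ * Q1mat m Q₀ * δ = Q1mat m Q₀ := hδ
    rw [← hd, ← Matrix.mulVec_mulVec, hxy', Matrix.mulVec_zero]
  exact sub_eq_zero.mp (aux_Q1_inj m Q₀ hpos _ this)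

lemma aux_mElt_mul (m : ℕ) (r s : ℚ) (g h : Matrix (Idx1 m) (Idx1 m) ℚ) :
    mElt m r g * mElt m s h = mElt m (r * s) (g * h) := by
  ext i j
  rcases i with _ | i | _ <;> rcases j with _ | j | _ <;>
    simp [Matrix.mul_apply, Fintype.sum_sum_type, mElt, mul_comm]

lemma aux_mElt_one (m : ℕ) : mElt m 1 1 = 1 := by
  ext i j
  rcases i with _ | i | _ <;> rcases j with _ | j | _ <;>
    simp [mElt, Matrix.one_apply]

lemma aux_mElt_inv (m : ℕ) (t : ℚ) (ht : t ≠ 0) (δ : Matrix (Idx1 m) (Idx1 m) ℚ)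
    (hδ : IsUnit δ) : mElt m t δ * (mElt m t δ)⁻¹ = 1 := by
  have h : mElt m t δ * mElt m t⁻¹ δ⁻¹ = 1 := by
    rw [aux_mElt_mul, mul_inv_cancel₀ ht,
      Matrix.mul_nonsing_inv _ ((Matrix.isUnit_iff_isUnit_det _).mp hδ), aux_mElt_one]
  rw [Matrix.inv_eq_right_inv h, h]

lemma aux_comm (m : ℕ) (Q₀ : Matrix (Fin (m - 2)) (Fin (m - 2)) ℚ)
    (δ : Matrix (Idx1 m) (Idx1 m) ℚ) (hδ : δ ∈ G1set m Q₀) (t : ℚ) (ht : t ≠ 0)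
    (X : Idx1 m → ℚ) :
    mElt m t δ * nElt m Q₀ X = nElt m Q₀ (t • δ.mulVec X) * mElt m t δ := by
  have hd : δᵀ * Q1mat m Q₀ * δ = Q1mat m Q₀ := hδ
  have h1 : ((δ.mulVec X) ᵥ* Q1mat m Q₀) ᵥ* δ = X ᵥ* Q1mat m Q₀ := by
    rw [← Matrix.vecMul_transpose, Matrix.vecMul_vecMul, Matrix.vecMul_vecMul,
      ← Matrix.mul_assoc, hd]
  have h2 : (δ.mulVec X) ⬝ᵥ (Q1mat m Q₀).mulVec (δ.mulVec X) = X ⬝ᵥ (Q1mat m Q₀).mulVec X := by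
    rw [Matrix.dotProduct_mulVec, Matrix.dotProduct_mulVec, h1, ← Matrix.dotProduct_mulVec]
  ext i j
  rcases i with _ | i | _ <;> rcases j with _ | j | _
  · simp [Matrix.mul_apply, Fintype.sum_sum_type, mElt, nElt]
  · have h1j := congrFun h1 j
    rw [Matrix.vecMul, dotProduct] at h1j
    rw [Matrix.mul_apply, Matrix.mul_apply, aux_sum, aux_sum]
    simp only [mElt, nElt, Matrix.smul_vecMul,
      Pi.smul_apply, smul_eq_mul, ← h1j, zero_mul, mul_zero, Finset.sum_const_zero, add_zero,
      zero_add, mul_neg, Finset.mul_sum, neg_mul, Finset.sum_neg_distrib, mul_assoc]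
  · rw [Matrix.mul_apply, Matrix.mul_apply, aux_sum, aux_sum]
    simp only [mElt, nElt, Matrix.mulVec_smul,
      smul_dotProduct, dotProduct_smul, smul_eq_mul, h2, zero_mul, mul_zero,
      Finset.sum_const_zero, add_zero, zero_add]
    field_simp
  · simp [Matrix.mul_apply, Fintype.sum_sum_type, mElt, nElt]
  · rw [Matrix.mul_apply, Matrix.mul_apply, aux_sum, aux_sum]
    simp [mElt, nElt, -Fintype.sum_sum_type]
  · rw [Matrix.mul_apply, Matrix.mul_apply, aux_sum, aux_sum]
    simp only [mElt, nElt, Pi.smul_apply, smul_eq_mul,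
      zero_mul, mul_zero, Finset.sum_const_zero, add_zero, zero_add, mul_one, Matrix.mulVec,
      dotProduct]
    field_simp
  · simp [Matrix.mul_apply, Fintype.sum_sum_type, mElt, nElt]
  · simp [Matrix.mul_apply, Fintype.sum_sum_type, mElt, nElt]
  · simp [Matrix.mul_apply, Fintype.sum_sum_type, mElt, nElt]

lemma aux_conj (m : ℕ) (Q₀ : Matrix (Fin (m - 2)) (Fin (m - 2)) ℚ)
    (hpos : ∀ x : Fin (m - 2) → ℚ, x ≠ 0 → 0 < x ⬝ᵥ Q₀.mulVec x)
    (δ : Matrix (Idx1 m) (Idx1 m) ℚ) (hδ : δ ∈ G1set m Q₀) (t : ℚ) (ht : t ≠ 0)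
    (X : Idx1 m → ℚ) :
    mElt m t δ * nElt m Q₀ X * (mElt m t δ)⁻¹ = nElt m Q₀ (t • δ.mulVec X) := by
  rw [aux_comm m Q₀ δ hδ t ht, Matrix.mul_assoc,
    aux_mElt_inv m t ht δ (aux_delta_unit m Q₀ hpos δ hδ), Matrix.mul_one]

lemma aux_n_e1 (m : ℕ) (Q₀ : Matrix (Fin (m - 2)) (Fin (m - 2)) ℚ) (X : Idx1 m → ℚ) :
    (nElt m Q₀ X).mulVec (e1 m) = e1 m := by
  funext i
  rcases i with _ | i | _ <;>
    simp [Matrix.mulVec, dotProduct, Fintype.sum_sum_type, nElt, e1]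

lemma aux_m_e1 (m : ℕ) (r : ℚ) (h : Matrix (Idx1 m) (Idx1 m) ℚ) :
    (mElt m r h).mulVec (e1 m) = r • e1 m := by
  funext i
  rcases i with _ | i | _ <;>
    simp [Matrix.mulVec, dotProduct, Fintype.sum_sum_type, mElt, e1]

lemma aux_P_e1 (m : ℕ) (Q₀ : Matrix (Fin (m - 2)) (Fin (m - 2)) ℚ)
    (p : Matrix (Idx m) (Idx m) ℚ) (hp : p ∈ Pset m Q₀) :
    ∃ r : ℚ, p.mulVec (e1 m) = r • e1 m := by
  obtain ⟨r, _, h, _, X, rfl⟩ := hp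
  exact ⟨r, by rw [← Matrix.mulVec_mulVec, aux_n_e1, aux_m_e1]⟩

lemma aux_w0_sq (m : ℕ) : w0 m * w0 m = 1 := by
  ext i j
  rcases i with _ | i | _ <;> rcases j with _ | j | _ <;>
    rw [Matrix.mul_apply, aux_sum] <;>
    simp [w0, Matrix.one_apply, -Fintype.sum_sum_type]

lemma aux_w1_sq (m : ℕ) : w1 m * w1 m = 1 := by
  ext i j
  rcases i with _ | (_ | i | _) | _ <;> rcases j with _ | (_ | j | _) | _ <;>
    simp [Matrix.mul_apply, Fintype.sum_sum_type, w1, Matrix.one_apply]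

lemma aux_n_neg (m : ℕ) (Q₀ : Matrix (Fin (m - 2)) (Fin (m - 2)) ℚ) (X : Idx1 m → ℚ) :
    nElt m Q₀ X * nElt m Q₀ (-X) = 1 := by
  have h : ∑ x, (X ᵥ* Q1mat m Q₀) x * X x = X ⬝ᵥ (Q1mat m Q₀).mulVec X := by
    rw [Matrix.dotProduct_mulVec]; rfl
  ext i j
  rcases i with _ | i | _ <;> rcases j with _ | j | _ <;>
    rw [Matrix.mul_apply, aux_sum] <;>
    simp [nElt, Matrix.one_apply, -Fintype.sum_sum_type, Matrix.mulVec_neg, Matrix.neg_vecMul, h]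
  ring

lemma aux_w0_case (m : ℕ) (Q₀ : Matrix (Fin (m - 2)) (Fin (m - 2)) ℚ) (Y : Idx1 m → ℚ) (r : ℚ)
    (h : (w0 m * nElt m Q₀ Y * w0 m).mulVec (e1 m) = r • e1 m) : Y = 0 := by
  have h1 : (w0 m).mulVec (e1 m) = - e1' m := by
    funext i
    rcases i with _ | i | _ <;>
      simp [Matrix.mulVec, dotProduct, Fintype.sum_sum_type, w0, e1, e1']
  have h2 : (nElt m Q₀ Y * w0 m).mulVec (e1 m) = (w0 m).mulVec (r • e1 m) := by
    rw [← h, Matrix.mulVec_mulVec, Matrix.mul_assoc, ← Matrix.mul_assoc (w0 m), aux_w0_sq,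
      Matrix.one_mul]
  rw [← Matrix.mulVec_mulVec, Matrix.mulVec_smul, h1] at h2
  funext c
  have := congrFun h2 (Sum.inr (Sum.inl c))
  simpa [Matrix.mulVec, dotProduct, Fintype.sum_sum_type, nElt, e1'] using this

lemma aux_w1_case (m : ℕ) (Q₀ : Matrix (Fin (m - 2)) (Fin (m - 2)) ℚ) (Y : Idx1 m → ℚ)
    (a : ℚ) (α : Fin (m - 2) → ℚ)
    (h : (w1 m * nElt m Q₀ Y * w1 m).mulVec (xiV m a α) = xiV m a α) : Y = 0 := by
  have h2 : (nElt m Q₀ Y).mulVec ((w1 m).mulVec (xiV m a α)) = (w1 m).mulVec (xiV m a α) := by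
    conv_rhs => rw [← h]
    rw [Matrix.mulVec_mulVec, Matrix.mulVec_mulVec, Matrix.mul_assoc, ← Matrix.mul_assoc (w1 m),
      aux_w1_sq, Matrix.one_mul]
  have hl : ((w1 m).mulVec (xiV m a α)) (Sum.inr (Sum.inr ())) = 1 := by
    simp [Matrix.mulVec, dotProduct, Fintype.sum_sum_type, w1, xiV, intoV, xiVec]
  generalize (w1 m).mulVec (xiV m a α) = v at h2 hl
  funext c
  have := congrFun h2 (Sum.inr (Sum.inl c))
  rw [Matrix.mulVec, dotProduct, aux_sum] at this
  simpa [nElt, -Fintype.sum_sum_type, hl] using this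

lemma aux_n_xi (m : ℕ) (Q₀ : Matrix (Fin (m - 2)) (Fin (m - 2)) ℚ) (Y x : Idx1 m → ℚ) :
    (nElt m Q₀ Y).mulVec (intoV m x) = intoV m x ↔ pairQ1 m Q₀ Y x = 0 := by
  have key : (nElt m Q₀ Y).mulVec (intoV m x) = intoV m x - (pairQ1 m Q₀ Y x) • e1 m := by
    have h : ∑ c, (Y ᵥ* Q1mat m Q₀) c * x c = pairQ1 m Q₀ Y x := by
      rw [pairQ1, Matrix.dotProduct_mulVec]; rfl
    funext i
    rcases i with _ | i | _ <;>
      rw [Matrix.mulVec, dotProduct, aux_sum] <;>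
      simp [nElt, intoV, e1, -Fintype.sum_sum_type, h]
  rw [key]
  constructor
  · intro h
    have := congrFun h (Sum.inl ())
    simpa [intoV, e1] using this
  · intro h
    simp [h]

/-- (1) For `δ ∈ G₁(ℚ)` and `Z ∈ V₁`, the conjugate
`m(1;δ) n(Z) m(1;δ)⁻¹` lies in `P^ξ(ℚ)` iff `⟨δZ, ξ⟩ = 0`.
(2) For `γ = u·m(t;δ)` with `u ∈ {𝔴₁, 𝔴₀, n(ξ)𝔴₀}`, `t ≠ 0`, `δ ∈ G₁(ℚ)`, the only `X ∈ V₁`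
with `γ n(X) γ⁻¹ ∈ P^ξ(ℚ)` is `X = 0`. -/
theorem stmt4 (m : ℕ) (hm : 3 ≤ m)
    (Q₀ : Matrix (Fin (m - 2)) (Fin (m - 2)) ℚ) (hsym : Q₀.IsSymm)
    (hpos : ∀ x : Fin (m - 2) → ℚ, x ≠ 0 → 0 < x ⬝ᵥ Q₀.mulVec x)
    (a : ℚ) (α : Fin (m - 2) → ℚ)
    (hξ : pairQ1 m Q₀ (xiVec m a α) (xiVec m a α) < 0) :
    (∀ δ ∈ G1set m Q₀, ∀ Z : Idx1 m → ℚ,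
      (mElt m 1 δ * nElt m Q₀ Z * (mElt m 1 δ)⁻¹ ∈ Pxi m Q₀ a α ↔
        pairQ1 m Q₀ (δ.mulVec Z) (xiVec m a α) = 0)) ∧
    (∀ u ∈ ({w1 m, w0 m, nElt m Q₀ (xiVec m a α) * w0 m} :
        Set (Matrix (Idx m) (Idx m) ℚ)),
      ∀ t : ℚ, t ≠ 0 → ∀ δ ∈ G1set m Q₀, ∀ X : Idx1 m → ℚ,
        (u * mElt m t δ) * nElt m Q₀ X * (u * mElt m t δ)⁻¹ ∈ Pxi m Q₀ a α → X = 0) := by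
  refine ⟨?_, ?_⟩
  · intro δ hδ Z
    rw [aux_conj m Q₀ hpos δ hδ 1 one_ne_zero, one_smul]
    have hP : nElt m Q₀ (δ.mulVec Z) ∈ Pset m Q₀ :=
      ⟨1, one_ne_zero, 1, by simp [G1set], δ.mulVec Z, by rw [aux_mElt_one, Matrix.one_mul]⟩
    have hx := aux_n_xi m Q₀ (δ.mulVec Z) (xiVec m a α)
    exact ⟨fun h => hx.mp h.2, fun h => ⟨hP, hx.mpr h⟩⟩
  · intro u hu t ht δ hδ X hX
    have e : (u * mElt m t δ) * nElt m Q₀ X * (u * mElt m t δ)⁻¹ =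
        u * nElt m Q₀ (t • δ.mulVec X) * u⁻¹ := by
      rw [← aux_conj m Q₀ hpos δ hδ t ht, Matrix.mul_inv_rev]
      simp only [Matrix.mul_assoc]
    rw [e] at hX
    have hY : t • δ.mulVec X = 0 := by
      rcases hu with rfl | rfl | hu
      · rw [Matrix.inv_eq_right_inv (aux_w1_sq m)] at hX
        exact aux_w1_case m Q₀ _ a α hX.2
      · rw [Matrix.inv_eq_right_inv (aux_w0_sq m)] at hX
        obtain ⟨r, hr⟩ := aux_P_e1 m Q₀ _ hX.1
        exact aux_w0_case m Q₀ _ r hr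
      · have hu' : u = nElt m Q₀ (xiVec m a α) * w0 m := hu
        subst hu'
        have hn := aux_n_neg m Q₀ (xiVec m a α)
        have hn' := mul_eq_one_comm.mp hn
        rw [Matrix.mul_inv_rev, Matrix.inv_eq_right_inv (aux_w0_sq m),
          Matrix.inv_eq_right_inv hn] at hX
        obtain ⟨r, hr⟩ := aux_P_e1 m Q₀ _ hX.1
        apply aux_w0_case m Q₀ _ r
        have h3 := congrArg (fun v => (nElt m Q₀ (-xiVec m a α)).mulVec v) hr
        simp only [Matrix.mulVec_smul, aux_n_e1] at h3
        rw [← h3]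
        conv_lhs => rw [← aux_n_e1 m Q₀ (-xiVec m a α)]
        rw [Matrix.mulVec_mulVec, Matrix.mulVec_mulVec]
        congr 1
        simp only [← Matrix.mul_assoc, hn', Matrix.one_mul]
    have h0 : δ.mulVec X = 0 := (smul_eq_zero.mp hY).resolve_left ht
    have hinj := Matrix.mulVec_injective_iff_isUnit.mpr (aux_delta_unit m Q₀ hpos δ hδ)
    apply hinj
    rw [h0, Matrix.mulVec_zero]
end

section
/- Let n ≥ 2 be an integer and let η ∈ ℝⁿ with η ≠ 0. Then ∫_{S^{n-1}} exp(-2πi⟨η,ω⟩) dω = 2π ‖η‖^{1-n/2} J_{n/2-1}(2π‖η‖), where dω is the standard surface measure on the unit sphere S^{n-1} ⊂ ℝⁿ. -/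
open MeasureTheory
open scoped RealInnerProductSpace

/-- The Bessel function of the first kind `J_ν`, defined by its power series. -/
noncomputable def besselJ (ν : ℝ) (x : ℝ) : ℝ :=
  ∑' k : ℕ, (-1) ^ k / (k.factorial * Real.Gamma (ν + k + 1)) * (x / 2) ^ (ν + 2 * (k : ℝ))

/-- Half-integer values of the Gamma function. -/
lemma aux_gamma_half (k : ℕ) :
    Real.Gamma (k + 1 / 2) = (2 * k).factorial * √Real.pi / (4 ^ k * k.factorial) := by
  induction k with
  | zero => simp [-one_div, Real.Gamma_one_half_eq]
  | succ k ih =>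
    have h : ((k + 1 : ℕ) : ℝ) + 1 / 2 = (k + 1 / 2 : ℝ) + 1 := by push_cast; ring
    rw [h, Real.Gamma_add_one (by positivity), ih, show 2 * (k + 1) = 2 * k + 1 + 1 by ring,
      Nat.factorial_succ, Nat.factorial_succ, Nat.factorial_succ]
    push_cast
    field_simp
    ring

lemma aux_radial (q : ℕ) :
    ∫ x in Set.Ioi (0 : ℝ), x ^ q * Real.exp (-x ^ 2) = 1 / 2 * Real.Gamma (((q : ℝ) + 1) / 2) := by
  rw [← integral_rpow_mul_exp_neg_rpow (p := 2) (q := q) (by norm_num)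
    (by have : (0 : ℝ) ≤ q := by positivity
        linarith)]
  simp

lemma aux_odd (k : ℕ) : ∫ x : ℝ, x ^ (2 * k + 1) * Real.exp (-x ^ 2) = 0 := by
  have h := MeasureTheory.integral_neg_eq_self (fun x : ℝ => x ^ (2 * k + 1) * Real.exp (-x ^ 2)) volume
  have h2 : (fun x : ℝ => (-x) ^ (2 * k + 1) * Real.exp (-(-x) ^ 2))
      = fun x => -(x ^ (2 * k + 1) * Real.exp (-x ^ 2)) := by
    funext x
    rw [Odd.neg_pow ⟨k, rfl⟩]; simp
  rw [h2, integral_neg] at h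
  linarith

lemma aux_even (k : ℕ) : ∫ x : ℝ, x ^ (2 * k) * Real.exp (-x ^ 2) = Real.Gamma (k + 1 / 2) := by
  have h := integral_comp_abs (f := fun x : ℝ => x ^ (2 * k) * Real.exp (-x ^ 2))
  rw [aux_radial] at h
  simp only [pow_mul, sq_abs] at h
  simp only [pow_mul]
  rw [h]
  push_cast
  rw [show ((2 * (k : ℝ) + 1) / 2) = k + 1 / 2 by ring]
  ring

/-- Gaussian moments of a linear form. -/
lemma aux_gauss (n : ℕ) (hn : 2 ≤ n) (η : EuclideanSpace ℝ (Fin n)) (hη : η ≠ 0) (m : ℕ) :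
    ∫ x : EuclideanSpace ℝ (Fin n), ⟪η, x⟫ ^ m * Real.exp (-‖x‖ ^ 2)
      = ‖η‖ ^ m * (∫ x : ℝ, x ^ m * Real.exp (-x ^ 2)) * √Real.pi ^ (n - 1) := by
  have hη' : ‖η‖ ≠ 0 := norm_ne_zero_iff.mpr hη
  let i0 : Fin n := ⟨0, by omega⟩
  obtain ⟨b, hb⟩ := Orthonormal.exists_orthonormalBasis_extension_of_card_eq (𝕜 := ℝ)
    (E := EuclideanSpace ℝ (Fin n)) (ι := Fin n) (by simp)
    (v := fun _ => ‖η‖⁻¹ • η) (s := {i0}) (by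
      constructor
      · intro i
        simp [norm_smul, hη']
      · intro i j hij
        exact absurd (Subsingleton.elim i j) hij)
  have hb0 : η = ‖η‖ • b i0 := by
    rw [hb i0 rfl, smul_smul, mul_inv_cancel₀ hη', one_smul]
  have h1 := b.measurePreserving_repr_symm.integral_comp
    b.repr.symm.toHomeomorph.measurableEmbedding
    (fun x => ⟪η, x⟫ ^ m * Real.exp (-‖x‖ ^ 2))
  rw [← h1]
  have h2 := (PiLp.volume_preserving_toLp (Fin n)).integral_comp
    (MeasurableEquiv.toLp 2 (Fin n → ℝ)).measurableEmbedding
    (fun x : EuclideanSpace ℝ (Fin n) =>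
      ⟪η, b.repr.symm x⟫ ^ m * Real.exp (-‖b.repr.symm x‖ ^ 2))
  rw [← h2]
  have h3 : ∀ y : Fin n → ℝ,
      ⟪η, b.repr.symm (WithLp.toLp 2 y)⟫ ^ m * Real.exp (-‖b.repr.symm (WithLp.toLp 2 y)‖ ^ 2)
      = ∏ i, (fun (i : Fin n) (t : ℝ) =>
          (if i = i0 then (‖η‖ * t) ^ m else 1) * Real.exp (-t ^ 2)) i (y i) := by
    intro y
    have e1 : ⟪η, b.repr.symm (WithLp.toLp 2 y)⟫ = ‖η‖ * y i0 := by
      conv_lhs => rw [hb0]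
      rw [inner_smul_left, ← b.repr_apply_apply]
      simp
    have e2 : ‖b.repr.symm (WithLp.toLp 2 y)‖ ^ 2 = ∑ i, y i ^ 2 := by
      rw [LinearIsometryEquiv.norm_map, EuclideanSpace.norm_sq_eq]
      simp
    rw [e1, e2, Finset.prod_mul_distrib, ← Real.exp_sum, Finset.sum_neg_distrib]
    simp
  rw [integral_congr_ae (Filter.Eventually.of_forall h3)]
  refine (integral_fintype_prod_volume_eq_prod (𝕜 := ℝ) (E := fun _ : Fin n => ℝ)
    (fun (i : Fin n) (t : ℝ) =>
      (if i = i0 then (‖η‖ * t) ^ m else 1) * Real.exp (-t ^ 2))).trans ?_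
  rw [← Finset.mul_prod_erase _ _ (Finset.mem_univ i0)]
  congr 1
  · simp only [if_true, mul_pow, mul_assoc]
    rw [integral_const_mul]
  · rw [Finset.prod_congr rfl (g := fun _ => √Real.pi), Finset.prod_const]
    · simp
    · intro i hi
      have hi' : i ≠ i0 := Finset.ne_of_mem_erase hi
      simp only [if_neg hi', one_mul]
      simpa using integral_gaussian 1

/-- Polar coordinates. -/
lemma aux_polar (n : ℕ) (hn : 2 ≤ n) (η : EuclideanSpace ℝ (Fin n)) (m : ℕ) :
    ∫ x : EuclideanSpace ℝ (Fin n), ⟪η, x⟫ ^ m * Real.exp (-‖x‖ ^ 2)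
      = (∫ ω : Metric.sphere (0 : EuclideanSpace ℝ (Fin n)) 1,
          ⟪η, (ω : EuclideanSpace ℝ (Fin n))⟫ ^ m
          ∂(volume : Measure (EuclideanSpace ℝ (Fin n))).toSphere)
        * (1 / 2 * Real.Gamma (((m : ℝ) + n) / 2)) := by
  have : Nontrivial (EuclideanSpace ℝ (Fin n)) :=
    Module.nontrivial_of_finrank_pos (R := ℝ) (by simp; omega)
  calc
    _ = ∫ x : ({(0)}ᶜ : Set (EuclideanSpace ℝ (Fin n))),
          ⟪η, (x : EuclideanSpace ℝ (Fin n))⟫ ^ m * Real.exp (-‖x.1‖ ^ 2)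
          ∂((volume : Measure (EuclideanSpace ℝ (Fin n))).comap (↑)) := by
      rw [integral_subtype_comap (measurableSet_singleton _).compl
        fun x : EuclideanSpace ℝ (Fin n) ↦ ⟪η, x⟫ ^ m * Real.exp (-‖x‖ ^ 2),
        MeasureTheory.restrict_compl_singleton]
    _ = ∫ p, (⟪η, (p.1 : EuclideanSpace ℝ (Fin n))⟫ ^ m) *
          ((p.2 : ℝ) ^ m * Real.exp (-(p.2 : ℝ) ^ 2))
          ∂(volume : Measure (EuclideanSpace ℝ (Fin n))).toSphere.prod
            (.volumeIoiPow (Module.finrank ℝ (EuclideanSpace ℝ (Fin n)) - 1)) := by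
      rw [← (volume : Measure (EuclideanSpace ℝ (Fin n))).measurePreserving_homeomorphUnitSphereProd.integral_comp
        (Homeomorph.measurableEmbedding _)]
      refine integral_congr_ae (Filter.Eventually.of_forall fun x => ?_)
      have hx : ‖x.1‖ ≠ 0 := norm_ne_zero_iff.mpr x.2
      simp [inner_smul_right, mul_pow, inv_pow]
      field_simp
    _ = (∫ ω : Metric.sphere (0 : EuclideanSpace ℝ (Fin n)) 1,
          ⟪η, (ω : EuclideanSpace ℝ (Fin n))⟫ ^ m
          ∂(volume : Measure (EuclideanSpace ℝ (Fin n))).toSphere) *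
        ∫ r : Set.Ioi (0 : ℝ), ((r : ℝ) ^ m * Real.exp (-(r : ℝ) ^ 2))
          ∂.volumeIoiPow (Module.finrank ℝ (EuclideanSpace ℝ (Fin n)) - 1) :=
      integral_prod_mul (L := ℝ)
        (fun ω : Metric.sphere (0 : EuclideanSpace ℝ (Fin n)) 1 =>
          ⟪η, (ω : EuclideanSpace ℝ (Fin n))⟫ ^ m)
        (fun r : Set.Ioi (0 : ℝ) => (r : ℝ) ^ m * Real.exp (-(r : ℝ) ^ 2))
    _ = _ := by
      congr 1
      simp only [Measure.volumeIoiPow, ENNReal.ofReal]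
      rw [integral_withDensity_eq_integral_smul]
      · rw [integral_subtype_comap measurableSet_Ioi fun a : ℝ ↦ Real.toNNReal
          (a ^ (Module.finrank ℝ (EuclideanSpace ℝ (Fin n)) - 1)) •
            (a ^ m * Real.exp (-a ^ 2))]
        rw [setIntegral_congr_fun (g := fun a : ℝ => a ^ (m + (n - 1)) * Real.exp (-a ^ 2))
          measurableSet_Ioi, aux_radial]
        · rw [Nat.cast_add, Nat.cast_sub (by omega)]
          congr 3
          push_cast
          ring
        · intro x hx
          simp only [finrank_euclideanSpace, Fintype.card_fin]
          rw [NNReal.smul_def, Real.coe_toNNReal _ (pow_nonneg (le_of_lt hx) _), pow_add, smul_eq_mul]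
          ring
      · exact (measurable_subtype_coe.pow_const _).real_toNNReal

lemma aux_moment_odd (n : ℕ) (hn : 2 ≤ n) (η : EuclideanSpace ℝ (Fin n)) (hη : η ≠ 0) (k : ℕ) :
    ∫ ω : Metric.sphere (0 : EuclideanSpace ℝ (Fin n)) 1,
          ⟪η, (ω : EuclideanSpace ℝ (Fin n))⟫ ^ (2 * k + 1)
          ∂(volume : Measure (EuclideanSpace ℝ (Fin n))).toSphere = 0 := by
  have h := aux_polar n hn η (2 * k + 1)
  rw [aux_gauss n hn η hη, aux_odd] at h
  have hG : Real.Gamma ((((2 * k + 1 : ℕ) : ℝ) + n) / 2) ≠ 0 :=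
    (Real.Gamma_pos_of_pos (by positivity)).ne'
  have h' := h.symm
  simp only [mul_zero, zero_mul, mul_eq_zero, hG, or_false] at h'
  simpa using h'

lemma aux_moment_even (n : ℕ) (hn : 2 ≤ n) (η : EuclideanSpace ℝ (Fin n)) (hη : η ≠ 0) (k : ℕ) :
    ∫ ω : Metric.sphere (0 : EuclideanSpace ℝ (Fin n)) 1,
          ⟪η, (ω : EuclideanSpace ℝ (Fin n))⟫ ^ (2 * k)
          ∂(volume : Measure (EuclideanSpace ℝ (Fin n))).toSphere
      = 2 * ‖η‖ ^ (2 * k) * ((2 * k).factorial / (4 ^ k * k.factorial)) * √Real.pi ^ n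
        / Real.Gamma ((n : ℝ) / 2 + k) := by
  have h := aux_polar n hn η (2 * k)
  rw [aux_gauss n hn η hη, aux_even, aux_gamma_half] at h
  have e : (((2 * k : ℕ) : ℝ) + n) / 2 = (n : ℝ) / 2 + k := by push_cast; ring
  rw [e] at h
  have hn0 : (0 : ℝ) < n := by exact_mod_cast (by omega : 0 < n)
  have hG : Real.Gamma ((n : ℝ) / 2 + k) ≠ 0 := (Real.Gamma_pos_of_pos (by positivity)).ne'
  have hp : √Real.pi ^ n = √Real.pi * √Real.pi ^ (n - 1) := by
    rw [← pow_succ', Nat.sub_add_cancel (by omega)]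
  rw [eq_div_iff hG, hp]
  linear_combination -2 * h

lemma aux_term (n : ℕ) (hn : 2 ≤ n) (r : ℝ) (hr : 0 < r) (k : ℕ) :
    2 * Real.pi * r ^ (1 - (n : ℝ) / 2) *
      ((-1) ^ k / (k.factorial * Real.Gamma ((n : ℝ) / 2 - 1 + k + 1)) *
        (2 * Real.pi * r / 2) ^ ((n : ℝ) / 2 - 1 + 2 * (k : ℝ)))
    = (-1) ^ k * (2 * Real.pi) ^ (2 * k) / (2 * k).factorial *
      (2 * r ^ (2 * k) * ((2 * k).factorial / (4 ^ k * k.factorial)) * √Real.pi ^ n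
        / Real.Gamma ((n : ℝ) / 2 + k)) := by
  have hn0 : (0 : ℝ) < n := by exact_mod_cast (by omega : 0 < n)
  have hG : Real.Gamma ((n : ℝ) / 2 + k) ≠ 0 := (Real.Gamma_pos_of_pos (by positivity)).ne'
  have hpi := Real.pi_pos
  rw [show (n : ℝ) / 2 - 1 + k + 1 = n / 2 + k by ring,
    show 2 * Real.pi * r / 2 = Real.pi * r by ring,
    Real.mul_rpow hpi.le hr.le]
  have e1 : √Real.pi ^ n = Real.pi ^ ((n : ℝ) / 2 - 1) * Real.pi := by
    rw [← Real.rpow_add_one hpi.ne', Real.sqrt_eq_rpow, ← Real.rpow_natCast, ← Real.rpow_mul hpi.le]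
    congr 1
    ring
  have e2 : Real.pi ^ ((n : ℝ) / 2 - 1 + 2 * (k : ℝ)) =
      Real.pi ^ ((n : ℝ) / 2 - 1) * Real.pi ^ (2 * k) := by
    rw [Real.rpow_add hpi, ← Real.rpow_natCast]; push_cast; rfl
  have e3 : r ^ (1 - (n : ℝ) / 2) * r ^ ((n : ℝ) / 2 - 1 + 2 * (k : ℝ)) = r ^ (2 * k) := by
    rw [← Real.rpow_add hr, ← Real.rpow_natCast]; congr 1; push_cast; ring
  have e4 : (2 * Real.pi) ^ (2 * k) = 4 ^ k * Real.pi ^ (2 * k) := by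
    rw [mul_pow, pow_mul]; norm_num
  have hf : ((2 * k).factorial : ℝ) ≠ 0 := by positivity
  rw [e1, e2, e4, ← e3]
  field_simp

/-- For `n ≥ 2` and `0 ≠ η ∈ ℝⁿ`,
`∫_{S^{n-1}} exp(-2πi⟨η,ω⟩) dω = 2π ‖η‖^{1-n/2} J_{n/2-1}(2π‖η‖)`, where `dω` is the surface
measure on the unit sphere, normalized so that Lebesgue measure is `dω × r^{n-1}dr`. -/
theorem stmt9 (n : ℕ) (hn : 2 ≤ n) (η : EuclideanSpace ℝ (Fin n)) (hη : η ≠ 0) :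
    (∫ ω : Metric.sphere (0 : EuclideanSpace ℝ (Fin n)) 1,
        Complex.exp (-2 * Real.pi * Complex.I *
          (⟪η, (ω : EuclideanSpace ℝ (Fin n))⟫ : ℝ))
        ∂(volume : Measure (EuclideanSpace ℝ (Fin n))).toSphere)
      = ((2 * Real.pi * ‖η‖ ^ (1 - (n : ℝ) / 2) *
          besselJ ((n : ℝ) / 2 - 1) (2 * Real.pi * ‖η‖) : ℝ) : ℂ) := by
  have hr : 0 < ‖η‖ := norm_pos_iff.mpr hη
  have hsum := hasSum_integral_of_dominated_convergence
    (μ := (volume : Measure (EuclideanSpace ℝ (Fin n))).toSphere)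
    (F := fun (m : ℕ) (ω : Metric.sphere (0 : EuclideanSpace ℝ (Fin n)) 1) =>
      ((-2 * Real.pi * Complex.I) ^ m / m.factorial) *
        ((⟪η, (ω : EuclideanSpace ℝ (Fin n))⟫ ^ m : ℝ) : ℂ))
    (f := fun ω => Complex.exp (-2 * Real.pi * Complex.I *
          (⟪η, (ω : EuclideanSpace ℝ (Fin n))⟫ : ℝ)))
    (fun m _ => (2 * Real.pi * ‖η‖) ^ m / m.factorial)
    (fun m => by
      apply Continuous.aestronglyMeasurable
      fun_prop)
    (fun m => Filter.Eventually.of_forall fun ω => by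
      have h1 : |⟪η, (ω : EuclideanSpace ℝ (Fin n))⟫| ≤ ‖η‖ := by
        simpa using abs_real_inner_le_norm η (ω : EuclideanSpace ℝ (Fin n))
      simp only [norm_mul, norm_div, norm_pow, norm_neg, Complex.norm_I, Complex.norm_real,
        Complex.norm_natCast, Real.norm_eq_abs, abs_of_pos Real.pi_pos, Complex.norm_ofNat,
        mul_pow, one_pow, mul_one]
      rw [div_mul_eq_mul_div]
      gcongr)
    (Filter.Eventually.of_forall fun ω => Real.summable_pow_div_factorial _)
    (integrable_const _)
    (Filter.Eventually.of_forall fun ω => by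
      have h := NormedSpace.expSeries_div_hasSum_exp (𝔸 := ℂ) (-2 * Real.pi * Complex.I *
          ((⟪η, (ω : EuclideanSpace ℝ (Fin n))⟫ : ℝ) : ℂ))
      rw [← Complex.exp_eq_exp_ℂ] at h
      refine h.congr_fun fun m => ?_
      push_cast
      rw [mul_pow]
      ring)
  simp only [integral_const_mul, integral_complex_ofReal] at hsum
  have hinj : Function.Injective (fun k : ℕ => 2 * k) := fun a b h => by
    simp only at h; omega
  rw [← hinj.hasSum_iff] at hsum
  · rw [← hsum.tsum_eq, besselJ, ← tsum_mul_left, Complex.ofReal_tsum]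
    congr 1
    funext k
    rw [aux_term n hn _ hr]
    simp only [Function.comp]
    rw [aux_moment_even n hn η hη]
    rw [show (-2 * (Real.pi : ℂ) * Complex.I) ^ (2 * k) = (-1) ^ k * (2 * Real.pi) ^ (2 * k) by
      rw [mul_pow, pow_mul Complex.I, Complex.I_sq, neg_mul, Even.neg_pow ⟨k, by ring⟩]; ring]
    push_cast
    rfl
  · intro m hm
    obtain ⟨k, rfl | rfl⟩ := m.even_or_odd'
    · exact absurd ⟨k, rfl⟩ hm
    · rw [aux_moment_odd n hn η hη]
      simp
end

section
/- Let m ≥ 3 be an integer and ρ = (m-1)/2. Let a, s ∈ ℂ with Re(a) > 0 and Re(s) > 0, and let η ∈ ℝ^{m-1}. Then the integral ∫_{ℝ^{m-1}} (‖Z‖² + a²)^{-(s+ρ)} exp(-2πi⟨η,Z⟩) dZ converges absolutely, and: if η = 0, it equals π^ρ · Γ(s)/Γ(s+ρ) · a^{-2s}; if η ≠ 0, it equals π^ρ · Γ(s+ρ)^{-1} · 2 (π‖η‖)^s a^{-s} K_s(2π a ‖η‖). -/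
open MeasureTheory
open scoped RealInnerProductSpace

/-- The modified Bessel function of the second kind `K_s(w)`, for `Re w > 0`, defined by its
integral representation `K_s(w) = (1/2)∫₀^∞ exp(-(v+v⁻¹)w/2) v^{s-1} dv`. -/
noncomputable def besselK (s w : ℂ) : ℂ :=
  (1 / 2) * ∫ v in Set.Ioi (0 : ℝ),
    Complex.exp (-((v + v⁻¹ : ℝ) : ℂ) * w / 2) * ((v : ℂ) ^ (s - 1))

lemma aux_gamma_integrable {w z : ℂ} (hw : 0 < w.re) (hz : 0 < z.re) :
    IntegrableOn (fun t : ℝ => (t : ℂ) ^ (w - 1) * Complex.exp (-(z * t))) (Set.Ioi 0) := by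
  have h := integrableOn_rpow_mul_exp_neg_mul_rpow (p := 1) (s := w.re - 1) (b := z.re)
    (by linarith) one_pos hz
  refine Integrable.mono' h ?_ ?_
  · exact (by fun_prop : Measurable (fun t : ℝ => (t : ℂ) ^ (w - 1) * Complex.exp (-(z * t)))).aestronglyMeasurable
  · refine (ae_restrict_iff' measurableSet_Ioi).2 (ae_of_all _ fun t ht => ?_)
    rw [norm_mul, Complex.norm_cpow_eq_rpow_re_of_pos ht, Complex.norm_exp]
    simp

lemma aux_gamma_deriv {w z : ℂ} (hw : 0 < w.re) (hz : 0 < z.re) :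
    DifferentiableAt ℂ (fun z : ℂ => ∫ t in Set.Ioi (0:ℝ),
      (t : ℂ) ^ (w - 1) * Complex.exp (-(z * t))) z := by
  have key := hasDerivAt_integral_of_dominated_loc_of_deriv_le
    (μ := volume.restrict (Set.Ioi (0:ℝ))) (𝕜 := ℂ)
    (F := fun (z : ℂ) (t : ℝ) => (t : ℂ) ^ (w - 1) * Complex.exp (-(z * t)))
    (F' := fun (z : ℂ) (t : ℝ) => (t : ℂ) ^ (w - 1) * (Complex.exp (-(z * t)) * (-t)))
    (bound := fun t => t ^ w.re * Real.exp (-(z.re / 2) * t ^ (1:ℝ)))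
    (s := {y : ℂ | z.re / 2 < y.re}) (x₀ := z)
    ((isOpen_lt continuous_const Complex.continuous_re).mem_nhds (by simp; linarith))
    (Filter.Eventually.of_forall fun y =>
      (by fun_prop : Measurable (fun t : ℝ => (t : ℂ) ^ (w - 1) * Complex.exp (-(y * t)))).aestronglyMeasurable)
    (aux_gamma_integrable hw hz)
    (by fun_prop : Measurable (fun t : ℝ => (t : ℂ) ^ (w - 1) * (Complex.exp (-(z * t)) * (-t)))).aestronglyMeasurable
    ?_
    (integrableOn_rpow_mul_exp_neg_mul_rpow (by linarith) one_pos (by linarith))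
    ?_
  · exact key.2.differentiableAt
  · refine (ae_restrict_iff' measurableSet_Ioi).2 (ae_of_all _ fun t ht y hy => ?_)
    have ht' : (0:ℝ) < t := ht
    have hy' : z.re / 2 < y.re := hy
    rw [norm_mul, Complex.norm_cpow_eq_rpow_re_of_pos ht, norm_mul, Complex.norm_exp]
    have e : t ^ w.re = t ^ (w - 1).re * t := by
      rw [Complex.sub_re, Complex.one_re, Real.rpow_sub_one ht'.ne']; field_simp
    rw [e, norm_neg, Complex.norm_real, Real.norm_of_nonneg ht'.le, Real.rpow_one]
    have : Real.exp (-(y * t)).re ≤ Real.exp (-(z.re / 2) * t) := by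
      apply Real.exp_le_exp.2
      simp
      nlinarith
    calc _ = (t ^ (w - 1).re * t) * Real.exp (-(y * t)).re := by ring
      _ ≤ _ := by gcongr
  · refine ae_of_all _ fun t y _ => ?_
    have h1 : HasDerivAt (fun y : ℂ => -(y * t)) (-t : ℂ) y := by
      have h0 := (hasDerivAt_mul_const (x := y) (t:ℂ)).neg
      exact h0
    exact (h1.cexp).const_mul _

lemma aux_gamma {w z : ℂ} (hw : 0 < w.re) (hz : 0 < z.re) :
    ∫ t in Set.Ioi (0:ℝ), (t : ℂ) ^ (w - 1) * Complex.exp (-(z * t)) =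
      z ^ (-w) * Complex.Gamma w := by
  set U : Set ℂ := {z : ℂ | 0 < z.re} with hU
  have hUo : IsOpen U := isOpen_lt continuous_const Complex.continuous_re
  have hUc : IsPreconnected U := (convex_halfSpace_re_gt 0).isPreconnected
  have hf : AnalyticOnNhd ℂ (fun z : ℂ => ∫ t in Set.Ioi (0:ℝ),
      (t : ℂ) ^ (w - 1) * Complex.exp (-(z * t))) U :=
    DifferentiableOn.analyticOnNhd (fun y hy => (aux_gamma_deriv hw hy).differentiableWithinAt) hUo
  have hg : AnalyticOnNhd ℂ (fun z : ℂ => z ^ (-w) * Complex.Gamma w) U := by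
    refine DifferentiableOn.analyticOnNhd (fun y hy => ?_) hUo
    refine DifferentiableAt.differentiableWithinAt ?_
    exact (differentiableAt_id.cpow_const (Or.inl hy)).mul_const _
  refine hf.eqOn_of_preconnected_of_frequently_eq hg hUc (z₀ := 1) (by simp [hU]) ?_ hz
  have ht : Filter.Tendsto (fun x : ℝ => (x : ℂ)) (nhdsWithin 1 {1}ᶜ) (nhdsWithin 1 {1}ᶜ) := by
    refine tendsto_nhdsWithin_of_tendsto_nhds_of_eventually_within _ ?_ ?_
    · exact (Complex.continuous_ofReal.tendsto' 1 1 (by simp)).mono_left nhdsWithin_le_nhds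
    · filter_upwards [self_mem_nhdsWithin] with x hx
      simpa using hx
  refine ht.frequently (Filter.Eventually.frequently ?_)
  have : ∀ᶠ x : ℝ in nhdsWithin 1 {1}ᶜ, 0 < x :=
    nhdsWithin_le_nhds (lt_mem_nhds one_pos)
  filter_upwards [this] with x hx
  have := Complex.integral_cpow_mul_exp_neg_mul_Ioi hw hx
  rw [this, one_div, Complex.inv_cpow, Complex.cpow_neg]
  rw [Complex.arg_ofReal_of_nonneg hx.le]
  exact Real.pi_ne_zero.symm

lemma aux_mul_cpow {x y : ℂ} (hx : 0 < x.re) (hy : 0 < y.re) (r : ℂ) :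
    (x * y) ^ r = x ^ r * y ^ r := by
  have hx0 : x ≠ 0 := by rintro rfl; simp at hx
  have hy0 : y ≠ 0 := by rintro rfl; simp at hy
  have h1 := abs_lt.1 (Complex.abs_arg_lt_pi_div_two_iff.2 (Or.inl hx))
  have h2 := abs_lt.1 (Complex.abs_arg_lt_pi_div_two_iff.2 (Or.inl hy))
  rw [Complex.cpow_def_of_ne_zero hx0, Complex.cpow_def_of_ne_zero hy0,
    Complex.cpow_def_of_ne_zero (mul_ne_zero hx0 hy0),
    (Complex.log_mul_eq_add_log_iff hx0 hy0).2 ⟨by linarith [h1.1, h2.1], by linarith [h1.2, h2.2]⟩,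
    add_mul, Complex.exp_add]

lemma aux_inv_re {a : ℂ} (ha : 0 < a.re) : 0 < (a⁻¹).re := by
  have hx0 : a ≠ 0 := by rintro rfl; simp at ha
  rw [Complex.inv_re]
  exact div_pos ha (Complex.normSq_pos.2 hx0)

/-- the two-variable integrand -/
noncomputable def auxF (n : ℕ) (a s : ℂ) (η : EuclideanSpace ℝ (Fin n))
    (u : ℝ) (Z : EuclideanSpace ℝ (Fin n)) : ℂ :=
  (u : ℂ) ^ (s + (n : ℂ) / 2 - 1) * Complex.exp (-(a * u)) *
    Complex.exp (-(u * a⁻¹) * (‖Z‖ : ℂ) ^ 2 + (-2 * Real.pi * Complex.I) * (⟪η, Z⟫ : ℝ))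

lemma auxF_norm (n : ℕ) (a s : ℂ) (η : EuclideanSpace ℝ (Fin n)) {u : ℝ} (hu : 0 < u)
    (Z : EuclideanSpace ℝ (Fin n)) :
    ‖auxF n a s η u Z‖ = u ^ (s.re + (n : ℝ) / 2 - 1) * Real.exp (-(a.re * u)) *
      Real.exp (-(u * (a⁻¹).re) * ‖Z‖ ^ 2) := by
  rw [auxF, norm_mul, norm_mul, Complex.norm_cpow_eq_rpow_re_of_pos hu, Complex.norm_exp,
    Complex.norm_exp]
  congr 2
  · simp
  · congr 1; simp
  · rw [← Complex.ofReal_pow]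
    have h2 : (-2 * Real.pi * Complex.I * ((⟪η, Z⟫ : ℝ) : ℂ)).re = 0 := by simp
    rw [Complex.add_re, h2, add_zero, Complex.re_mul_ofReal, Complex.neg_re, Complex.re_ofReal_mul]

lemma auxF_integrable (n : ℕ) (a s : ℂ) (ha : 0 < a.re) (hs : 0 < s.re)
    (η : EuclideanSpace ℝ (Fin n)) :
    Integrable (Function.uncurry (auxF n a s η))
      ((volume.restrict (Set.Ioi (0:ℝ))).prod volume) := by
  have hc := aux_inv_re ha
  have hm : Measurable (Function.uncurry (auxF n a s η)) := by
    unfold auxF Function.uncurry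
    fun_prop
  rw [integrable_prod_iff hm.aestronglyMeasurable]
  constructor
  · refine (ae_restrict_iff' measurableSet_Ioi).2 (ae_of_all _ fun u hu => ?_)
    have hu' : (0:ℝ) < u := hu
    simp only [Function.uncurry, auxF]
    refine (GaussianFourier.integrable_cexp_neg_mul_sq_norm_add (b := (u * a⁻¹)) ?_ _ η).const_mul _
    rw [Complex.re_ofReal_mul]; positivity
  · have h := (integrableOn_rpow_mul_exp_neg_mul_rpow (p := 1) (s := s.re - 1) (b := a.re)
      (by linarith) one_pos ha).const_mul ((Real.pi / (a⁻¹).re) ^ ((n : ℝ) / 2))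
    refine h.congr ?_
    refine (ae_restrict_iff' measurableSet_Ioi).2 (ae_of_all _ fun u hu => ?_)
    have hu' : (0:ℝ) < u := hu
    simp only [Function.uncurry, auxF_norm n a s η hu']
    rw [integral_const_mul, GaussianFourier.integral_rexp_neg_mul_sq_norm (by positivity)]
    rw [finrank_euclideanSpace_fin, mul_comm u, ← div_div,
      Real.div_rpow (by positivity) hu'.le, add_sub_right_comm, Real.rpow_add hu', Real.rpow_one]
    field_simp

lemma auxF_int_u (n : ℕ) (a s : ℂ) (ha : 0 < a.re) (hs : 0 < s.re)
    (η Z : EuclideanSpace ℝ (Fin n)) :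
    ∫ u in Set.Ioi (0:ℝ), auxF n a s η u Z =
      a ^ (s + (n : ℂ) / 2) * Complex.Gamma (s + (n : ℂ) / 2) *
      (((‖Z‖ : ℂ) ^ 2 + a ^ 2) ^ (-(s + (n : ℂ) / 2)) *
        Complex.exp (-2 * Real.pi * Complex.I * (⟪η, Z⟫ : ℝ))) := by
  have ha0 : a ≠ 0 := by rintro rfl; simp at ha
  have hc := aux_inv_re ha
  set w := s + (n : ℂ) / 2 with hw
  have hwre : 0 < w.re := by
    have : w.re = s.re + (n : ℝ) / 2 := by simp [hw]
    rw [this]; positivity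
  have hz : 0 < (a + a⁻¹ * (‖Z‖ : ℂ) ^ 2).re := by
    rw [← Complex.ofReal_pow, Complex.add_re, Complex.re_mul_ofReal]; positivity
  have e : ∀ u : ℝ, auxF n a s η u Z =
      (u : ℂ) ^ (w - 1) * Complex.exp (-((a + a⁻¹ * (‖Z‖ : ℂ) ^ 2) * u)) *
        Complex.exp (-2 * Real.pi * Complex.I * (⟪η, Z⟫ : ℝ)) := by
    intro u
    rw [auxF, ← hw, mul_assoc, ← Complex.exp_add, mul_assoc ((u : ℂ) ^ (w - 1)), ← Complex.exp_add]
    congr 2; ring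
  simp_rw [e]
  rw [integral_mul_const, aux_gamma hwre hz]
  have : (‖Z‖ : ℂ) ^ 2 + a ^ 2 = a * (a + a⁻¹ * (‖Z‖ : ℂ) ^ 2) := by
    field_simp; ring
  rw [this, aux_mul_cpow ha hz, Complex.cpow_neg a w]
  have : a ^ w ≠ 0 := by simp [Complex.cpow_eq_zero_iff, ha0]
  field_simp

lemma auxF_int_Z (n : ℕ) (a s : ℂ) (ha : 0 < a.re)
    (η : EuclideanSpace ℝ (Fin n)) {u : ℝ} (hu : 0 < u) :
    ∫ Z, auxF n a s η u Z = (Real.pi : ℂ) ^ ((n : ℂ) / 2) * a ^ ((n : ℂ) / 2) *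
      ((u : ℂ) ^ (s - 1) * Complex.exp (-(a * u)) *
        Complex.exp (- (Real.pi * ‖η‖) ^ 2 * a / u)) := by
  have ha0 : a ≠ 0 := by rintro rfl; simp at ha
  have hu0 : (u : ℂ) ≠ 0 := by exact_mod_cast hu.ne'
  have hc := aux_inv_re ha
  unfold auxF
  rw [integral_const_mul, GaussianFourier.integral_cexp_neg_mul_sq_norm_add
    (by rw [Complex.re_ofReal_mul]; positivity), finrank_euclideanSpace_fin]
  have h1 : (Real.pi / (u * a⁻¹) : ℂ) = (((Real.pi / u : ℝ)) : ℂ) * a := by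
    push_cast; field_simp
  rw [h1, aux_mul_cpow (by rw [Complex.ofReal_re]; positivity) ha, Complex.ofReal_div,
    Complex.div_cpow_ofReal_nonneg Real.pi_pos.le hu.le,
    add_sub_right_comm, Complex.cpow_add _ _ hu0]
  have h2 : ((-2 * Real.pi * Complex.I) ^ 2 * (‖η‖ : ℂ) ^ 2 / (4 * (u * a⁻¹)) : ℂ) =
      - (Real.pi * ‖η‖) ^ 2 * a / u := by
    rw [mul_pow, Complex.I_sq]; field_simp; ring
  rw [h2]
  have : (u : ℂ) ^ ((n : ℂ) / 2) ≠ 0 := by simp [Complex.cpow_eq_zero_iff, hu0]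
  field_simp

lemma aux_main (n : ℕ) (a s : ℂ) (ha : 0 < a.re) (hs : 0 < s.re)
    (η : EuclideanSpace ℝ (Fin n)) :
    (Integrable fun Z : EuclideanSpace ℝ (Fin n) =>
      ((‖Z‖ : ℂ) ^ 2 + a ^ 2) ^ (-(s + (n : ℂ) / 2)) *
        Complex.exp (-2 * Real.pi * Complex.I * (⟪η, Z⟫ : ℝ))) ∧
    (∫ Z : EuclideanSpace ℝ (Fin n),
          ((‖Z‖ : ℂ) ^ 2 + a ^ 2) ^ (-(s + (n : ℂ) / 2)) *
            Complex.exp (-2 * Real.pi * Complex.I * (⟪η, Z⟫ : ℝ))) =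
      (Real.pi : ℂ) ^ ((n : ℂ) / 2) / Complex.Gamma (s + (n : ℂ) / 2) * (a ^ (-s) *
        ∫ u in Set.Ioi (0:ℝ), ((u : ℂ) ^ (s - 1) * Complex.exp (-(a * u)) *
        Complex.exp (- (Real.pi * ‖η‖) ^ 2 * a / u))) := by
  have ha0 : a ≠ 0 := by rintro rfl; simp at ha
  have hF := auxF_integrable n a s ha hs η
  have hwre : 0 < (s + (n : ℂ) / 2).re := by
    have : (s + (n : ℂ) / 2).re = s.re + (n : ℝ) / 2 := by simp
    rw [this]; positivity
  have hG : Complex.Gamma (s + (n : ℂ) / 2) ≠ 0 := Complex.Gamma_ne_zero_of_re_pos hwre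
  have hA : ∀ r : ℂ, a ^ r ≠ 0 := fun r => by simp [Complex.cpow_eq_zero_iff, ha0]
  have hC : a ^ (s + (n : ℂ) / 2) * Complex.Gamma (s + (n : ℂ) / 2) ≠ 0 := mul_ne_zero (hA _) hG
  constructor
  · have h := hF.integral_prod_right
    simp only [Function.uncurry, auxF_int_u n a s ha hs η] at h
    exact (integrable_const_mul_iff (IsUnit.mk0 _ hC) _).1 h
  · have h := integral_integral_swap hF
    simp only [auxF_int_u n a s ha hs η] at h
    rw [integral_const_mul, setIntegral_congr_fun measurableSet_Ioi
      (fun u hu => auxF_int_Z n a s ha η hu), integral_const_mul] at h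
    refine mul_left_cancel₀ hC (h.symm.trans ?_)
    rw [Complex.cpow_add _ _ ha0, Complex.cpow_neg]
    have := hA s
    generalize (∫ u in Set.Ioi (0:ℝ), _ : ℂ) = J
    generalize Complex.Gamma (s + (n : ℂ) / 2) = G at hG ⊢
    field_simp

theorem stmt10 (m : ℕ) (hm : 3 ≤ m) (a s : ℂ) (ha : 0 < a.re) (hs : 0 < s.re)
    (η : EuclideanSpace ℝ (Fin (m - 1))) :
    (Integrable fun Z : EuclideanSpace ℝ (Fin (m - 1)) =>
      ((‖Z‖ : ℂ) ^ 2 + a ^ 2) ^ (-(s + ((m : ℂ) - 1) / 2)) *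
        Complex.exp (-2 * Real.pi * Complex.I * (⟪η, Z⟫ : ℝ))) ∧
    (η = 0 →
      (∫ Z : EuclideanSpace ℝ (Fin (m - 1)),
          ((‖Z‖ : ℂ) ^ 2 + a ^ 2) ^ (-(s + ((m : ℂ) - 1) / 2)) *
            Complex.exp (-2 * Real.pi * Complex.I * (⟪η, Z⟫ : ℝ)))
        = (Real.pi : ℂ) ^ (((m : ℂ) - 1) / 2) * (Complex.Gamma s /
            Complex.Gamma (s + ((m : ℂ) - 1) / 2)) * a ^ (-(2 * s))) ∧
    (η ≠ 0 →
      (∫ Z : EuclideanSpace ℝ (Fin (m - 1)),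
          ((‖Z‖ : ℂ) ^ 2 + a ^ 2) ^ (-(s + ((m : ℂ) - 1) / 2)) *
            Complex.exp (-2 * Real.pi * Complex.I * (⟪η, Z⟫ : ℝ)))
        = (Real.pi : ℂ) ^ (((m : ℂ) - 1) / 2) / Complex.Gamma (s + ((m : ℂ) - 1) / 2) *
            (2 * ((Real.pi * ‖η‖ : ℝ) : ℂ) ^ s * a ^ (-s) *
              besselK s (2 * Real.pi * a * (‖η‖ : ℂ)))) := by
  have ha0 : a ≠ 0 := by rintro rfl; simp at ha
  have hmn : ((m : ℂ) - 1) = ((m - 1 : ℕ) : ℂ) := by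
    rw [Nat.cast_sub (by omega)]; simp
  rw [hmn]
  obtain ⟨h1, h2⟩ := aux_main (m - 1) a s ha hs η
  refine ⟨h1, fun h0 => ?_, fun h0 => ?_⟩
  · rw [h2]
    simp only [h0, norm_zero, Complex.ofReal_zero, mul_zero, zero_pow two_ne_zero, neg_zero,
      zero_mul, zero_div, Complex.exp_zero, mul_one]
    rw [aux_gamma hs ha, show -(2 * s) = -s + -s by ring, Complex.cpow_add _ _ ha0]
    ring
  · rw [h2]
    have hp : 0 < Real.pi * ‖η‖ := mul_pos Real.pi_pos (norm_pos_iff.2 h0)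
    set p := Real.pi * ‖η‖ with hpdef
    have hp0 : (p : ℂ) ≠ 0 := by exact_mod_cast hp.ne'
    have hcv := integral_comp_mul_left_Ioi' (fun u : ℝ => ((u : ℂ) ^ (s - 1) *
      Complex.exp (-(a * u)) * Complex.exp (- (Real.pi * ‖η‖) ^ 2 * a / u))) 0 hp
    rw [mul_zero] at hcv
    rw [← hcv, besselK]
    have e : ∀ v ∈ Set.Ioi (0:ℝ), (((p * v : ℝ) : ℂ) ^ (s - 1) *
      Complex.exp (-(a * (p * v : ℝ))) *
        Complex.exp (- (Real.pi * ‖η‖) ^ 2 * a / (p * v : ℝ))) =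
      (p : ℂ) ^ (s - 1) * (Complex.exp (-((v + v⁻¹ : ℝ) : ℂ) *
        (2 * Real.pi * a * (‖η‖ : ℂ)) / 2) * ((v : ℂ) ^ (s - 1))) := by
      intro v hv
      have hv' : (0:ℝ) < v := hv
      have hv0 : (v : ℂ) ≠ 0 := by exact_mod_cast hv'.ne'
      have hq : (Real.pi * ‖η‖ : ℂ) = p := by rw [hpdef]; push_cast; rfl
      have hq2 : (2 * Real.pi * a * (‖η‖ : ℂ)) = 2 * p * a := by rw [← hq]; ring
      rw [hq, hq2, Complex.ofReal_mul, Complex.mul_cpow_ofReal_nonneg hp.le hv'.le, mul_assoc,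
        ← Complex.exp_add, mul_assoc, mul_comm (Complex.exp _) ((v : ℂ) ^ (s - 1))]
      congr 3
      push_cast
      field_simp
      ring
    rw [setIntegral_congr_fun measurableSet_Ioi e, integral_const_mul, Complex.real_smul,
      Complex.cpow_sub _ _ hp0, Complex.cpow_one]
    generalize (∫ u in Set.Ioi (0:ℝ), _ : ℂ) = J
    field_simp
end

section
/- Let V₁ be a finite-dimensional ℚ-vector space with a nondegenerate symmetric bilinear form ⟨·,·⟩, and let ξ ∈ V₁ satisfy ⟨ξ,ξ⟩ < 0; assume that the extension of the form to V₁ ⊗ ℝ is positive definite on the real orthogonal complement of ξ. Let M₁ ⊂ V₁ be a finitely generated ℤ-submodule. Then there exists ε > 0 such that for every ℚ-linear isometry δ of (V₁, ⟨·,·⟩) satisfying δ⁻¹ξ ∈ M₁ and δξ ∉ {ξ, -ξ}, one has |⟨δξ, ξ⟩ / ⟨ξ,ξ⟩| ≥ 1 + ε. -/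
open scoped TensorProduct

theorem aux_den {V : Type*} [AddCommGroup V] [Module ℚ V] (f : V →ₗ[ℚ] ℚ)
    (M : Submodule ℤ V) (hfg : M.FG) :
    ∃ N : ℕ, 0 < N ∧ ∀ m ∈ M, ∃ k : ℤ, (N : ℚ) * f m = k := by
  induction M, hfg using Submodule.fg_induction with
  | singleton x =>
    refine ⟨(f x).den, (f x).den_pos, ?_⟩
    intro m hm
    obtain ⟨a, rfl⟩ := Submodule.mem_span_singleton.mp hm
    refine ⟨a * (f x).num, ?_⟩
    have h := Rat.den_mul_eq_num (f x)
    rw [map_zsmul, zsmul_eq_mul]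
    push_cast
    rw [← h]
    ring
  | sup M₁ M₂ _ _ h₁ h₂ =>
    obtain ⟨N₁, p₁, h₁⟩ := h₁
    obtain ⟨N₂, p₂, h₂⟩ := h₂
    refine ⟨N₁ * N₂, Nat.mul_pos p₁ p₂, ?_⟩
    intro m hm
    obtain ⟨y, hy, z, hz, rfl⟩ := Submodule.mem_sup.mp hm
    obtain ⟨k, hk⟩ := h₁ y hy
    obtain ⟨l, hl⟩ := h₂ z hz
    refine ⟨N₂ * k + N₁ * l, ?_⟩
    push_cast
    rw [← hk, ← hl, map_add]
    ring

/-- Let `(V₁, ⟨·,·⟩)` be a nondegenerate symmetric bilinear space over `ℚ`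
with `⟨ξ,ξ⟩ < 0`, whose real extension is positive definite on the orthogonal complement of
`ξ`.  For every finitely generated `ℤ`-submodule `M₁ ⊂ V₁` there is `ε > 0` such that every
`ℚ`-isometry `δ` with `δ⁻¹ξ ∈ M₁` and `δξ ∉ {ξ, -ξ}` satisfies `|⟨δξ,ξ⟩/⟨ξ,ξ⟩| ≥ 1 + ε`. -/
theorem stmt14 (V : Type*) [AddCommGroup V] [Module ℚ V] [FiniteDimensional ℚ V]
    (B : LinearMap.BilinForm ℚ V) (hsymm : ∀ x y, B x y = B y x)
    (hnd : B.Nondegenerate) (ξ : V) (hξ : B ξ ξ < 0)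
    (Bᵣ : LinearMap.BilinForm ℝ (ℝ ⊗[ℚ] V))
    (hcompat : ∀ (r s : ℝ) (x y : V),
      Bᵣ (r ⊗ₜ[ℚ] x) (s ⊗ₜ[ℚ] y) = r * s * (B x y : ℝ))
    (hpos : ∀ w : ℝ ⊗[ℚ] V, Bᵣ w ((1 : ℝ) ⊗ₜ[ℚ] ξ) = 0 → w ≠ 0 → 0 < Bᵣ w w)
    (M₁ : Submodule ℤ V) (hfg : M₁.FG) :
    ∃ ε : ℝ, 0 < ε ∧ ∀ δ : V ≃ₗ[ℚ] V, (∀ x y, B (δ x) (δ y) = B x y) →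
      δ.symm ξ ∈ M₁ → δ ξ ≠ ξ → δ ξ ≠ -ξ →
      1 + ε ≤ |(B (δ ξ) ξ / B ξ ξ : ℚ)| := by
  obtain ⟨N, hN, hM⟩ := aux_den ((B ξ ξ)⁻¹ • B ξ) M₁ hfg
  have hNq : (0 : ℚ) < N := by exact_mod_cast hN
  refine ⟨((1 / N : ℚ) : ℝ), by exact_mod_cast one_div_pos.mpr hNq, ?_⟩
  intro δ hδ hm h1 h2
  have hq : B (δ ξ) ξ = B ξ (δ.symm ξ) := by
    have := hδ ξ (δ.symm ξ)
    rwa [LinearEquiv.apply_symm_apply] at this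
  have hmm : B (δ.symm ξ) (δ.symm ξ) = B ξ ξ := by
    have := hδ (δ.symm ξ) (δ.symm ξ)
    rw [LinearEquiv.apply_symm_apply] at this
    exact this.symm
  have hm1 : δ.symm ξ ≠ ξ := fun h => h1 (by
    conv_lhs => rw [← h]
    simp)
  have hm2 : δ.symm ξ ≠ -ξ := fun h => h2 (by
    have := congrArg δ h
    rw [LinearEquiv.apply_symm_apply, map_neg] at this
    conv_rhs => rw [this]
    simp)
  obtain ⟨k, hk⟩ := hM _ hm
  rw [hq]
  generalize δ.symm ξ = m at *
  obtain ⟨q, hqd⟩ : ∃ q, q = B ξ m / B ξ ξ := ⟨_, rfl⟩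
  have hqm : B ξ m = q * B ξ ξ := by rw [hqd]; field_simp [hξ.ne]
  have hk' : (N : ℚ) * q = k := by
    rw [← hk, hqd]; simp [div_eq_inv_mul]
  rw [← hqd]
  have hw1 : B (m - q • ξ) ξ = 0 := by
    simp [hsymm m ξ, hqm]
  have hw2 : B (m - q • ξ) (m - q • ξ) = (1 - q ^ 2) * B ξ ξ := by
    simp [hsymm m ξ, hqm, hmm]; ring
  have hw0 : m - q • ξ ≠ 0 := by
    intro h0
    rw [h0] at hw2
    have h3 : 1 - q ^ 2 = 0 := by
      simpa [hξ.ne] using hw2.symm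
    have h4 : q = 1 ∨ q = -1 := by
      have : q ^ 2 = 1 := by linarith
      simpa using this
    rcases h4 with h4 | h4
    · exact hm1 (by simpa [h4, sub_eq_zero] using h0)
    · exact hm2 (by
        rw [sub_eq_zero] at h0
        simpa [h4] using h0)
  have hpw : 0 < B (m - q • ξ) (m - q • ξ) := by
    generalize m - q • ξ = w at *
    have := hpos ((1 : ℝ) ⊗ₜ[ℚ] w) (by rw [hcompat, hw1]; simp) (by
      intro hz
      apply hw0
      apply hnd.1
      intro y
      have h5 := hcompat 1 1 w y
      rw [hz] at h5
      simpa using h5.symm)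
    rw [hcompat] at this
    simpa using this
  have hq1 : 1 < q ^ 2 := by
    rw [hw2] at hpw
    by_contra hcon
    nlinarith
  have hq2 : 1 < |q| := by
    rwa [one_lt_sq_iff_one_lt_abs] at hq1
  have hk2 : (N : ℚ) * |q| = ((|k| : ℤ) : ℚ) := by
    rw [Int.cast_abs, ← hk', abs_mul, abs_of_pos hNq]
  have hk3 : (N : ℤ) < |k| := by
    have : (N : ℚ) < ((|k| : ℤ) : ℚ) := by rw [← hk2]; nlinarith
    exact_mod_cast this
  have hk4 : (N : ℚ) + 1 ≤ N * |q| := by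
    rw [hk2]; exact_mod_cast hk3
  have hfin : 1 + 1 / (N : ℚ) ≤ |q| := by
    have : 1 + 1 / (N : ℚ) = (N + 1) / N := by field_simp
    rw [this, div_le_iff₀ hNq]
    linarith
  exact_mod_cast hfin
end

section
/- Let m ≥ 3 be an integer and ρ = (m-1)/2. Let α, A ∈ ℂ satisfy Re(A) > 0 and 2Re(α) < -(m-2). Then for every η ∈ ℝ^{m-2}, both integrals below converge absolutely and ∫_{ℝ^{m-2}} (‖Y‖² + A)^α exp(2πi⟨Y,η⟩) dY = 2π^{ρ-1} · Γ(-α-ρ+1)/Γ(-α) · ∫₀^∞ (u² + A)^{α+ρ-1} cos(2π‖η‖u) du. -/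
open MeasureTheory
open scoped RealInnerProductSpace


lemma aux_int (x b : ℝ) (hx : 0 < x) (hb : 0 < b) :
    IntegrableOn (fun t : ℝ => t ^ (x - 1) * Real.exp (-b * t)) (Set.Ioi 0) := by
  have := integrableOn_rpow_mul_exp_neg_mul_rpow (p := 1) (s := x - 1) (b := b)
    (by linarith) one_pos hb
  simpa using this

lemma aux_norm (a r : ℂ) (t : ℝ) (ht : 0 < t) :
    ‖(t : ℂ) ^ (a - 1) * Complex.exp (-(r * t))‖
      = t ^ (a.re - 1) * Real.exp (-r.re * t) := by
  rw [norm_mul, Complex.norm_cpow_eq_rpow_re_of_pos ht, Complex.norm_exp]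
  simp

lemma aux_cont (a r : ℂ) : ContinuousOn
    (fun t : ℝ => (t : ℂ) ^ (a - 1) * Complex.exp (-(r * t))) (Set.Ioi 0) := by
  intro t ht
  apply ContinuousAt.continuousWithinAt
  apply ContinuousAt.mul
  · exact Complex.continuousAt_ofReal_cpow_const _ _ (Or.inr (ne_of_gt ht))
  · fun_prop

lemma aux_cint (a r : ℂ) (ha : 0 < a.re) (hr : 0 < r.re) : IntegrableOn
    (fun t : ℝ => (t : ℂ) ^ (a - 1) * Complex.exp (-(r * t))) (Set.Ioi 0) := by
  refine Integrable.mono' (aux_int a.re r.re ha hr)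
    ((aux_cont a r).aestronglyMeasurable measurableSet_Ioi) ?_
  filter_upwards [ae_restrict_mem measurableSet_Ioi] with t ht
  rw [aux_norm a r t ht]

lemma aux_gamma_s15 (a r : ℂ) (ha : 0 < a.re) (hr : 0 < r.re) :
    ∫ t : ℝ in Set.Ioi 0, (t : ℂ) ^ (a - 1) * Complex.exp (-(r * t))
      = r ^ (-a) * Complex.Gamma a := by
  have hopen : IsOpen {z : ℂ | 0 < z.re} := isOpen_lt continuous_const Complex.continuous_re
  have hF : DifferentiableOn ℂ (fun r : ℂ => ∫ t : ℝ in Set.Ioi 0,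
      (t : ℂ) ^ (a - 1) * Complex.exp (-(r * t))) {z : ℂ | 0 < z.re} := by
    intro r0 hr0
    have hr0 : 0 < r0.re := hr0
    apply DifferentiableAt.differentiableWithinAt
    have hs : {z : ℂ | r0.re / 2 < z.re} ∈ nhds r0 :=
      (isOpen_lt continuous_const Complex.continuous_re).mem_nhds
        (show r0.re / 2 < r0.re by linarith)
    have key := hasDerivAt_integral_of_dominated_loc_of_deriv_le
      (μ := volume.restrict (Set.Ioi (0 : ℝ))) (𝕜 := ℂ)
      (F := fun (r : ℂ) (t : ℝ) => (t : ℂ) ^ (a - 1) * Complex.exp (-(r * t)))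
      (F' := fun (r : ℂ) (t : ℝ) => (t : ℂ) ^ (a - 1) * (Complex.exp (-(r * t)) * -(t : ℂ)))
      (bound := fun t : ℝ => t ^ ((a.re + 1) - 1) * Real.exp (-(r0.re / 2) * t))
      (x₀ := r0) hs ?_ ?_ ?_ ?_ ?_ ?_
    · exact key.2.differentiableAt
    · exact Filter.Eventually.of_forall fun r =>
        (aux_cont a r).aestronglyMeasurable measurableSet_Ioi
    · exact aux_cint a r0 ha hr0
    · refine ContinuousOn.aestronglyMeasurable ?_ measurableSet_Ioi
      have h2 : ContinuousOn (fun t : ℝ => -(t : ℂ)) (Set.Ioi 0) := by fun_prop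
      exact ((aux_cont a r0).mul h2).congr fun t _ => by simp [mul_assoc]
    · filter_upwards [ae_restrict_mem measurableSet_Ioi] with t ht z hz
      have hz : r0.re / 2 < z.re := hz
      have ht' : 0 < t := ht
      rw [← mul_assoc, norm_mul, aux_norm a z t ht, norm_neg, Complex.norm_real,
        Real.norm_of_nonneg ht'.le, add_sub_cancel_right]
      have : t ^ a.re = t ^ (a.re - 1) * t := by
        rw [Real.rpow_sub_one ht'.ne']; field_simp
      rw [this]
      have : Real.exp (-z.re * t) ≤ Real.exp (-(r0.re / 2) * t) := by
        apply Real.exp_le_exp.2; nlinarith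
      have h0 : 0 ≤ t ^ (a.re - 1) := by positivity
      calc _ = t ^ (a.re - 1) * t * Real.exp (-z.re * t) := by ring
        _ ≤ _ := by gcongr
    · exact aux_int (a.re + 1) _ (by linarith) (by linarith)
    · refine Filter.Eventually.of_forall fun t z _ => ?_
      have h1 : HasDerivAt (fun z : ℂ => -(z * t)) (-(t : ℂ)) z := by
        have h2 := ((hasDerivAt_id z).mul_const (t : ℂ)).fun_neg
        simpa only [id, one_mul] using h2
      exact (h1.cexp).const_mul _
  have hG : DifferentiableOn ℂ (fun r : ℂ => r ^ (-a) * Complex.Gamma a) {z : ℂ | 0 < z.re} := by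
    intro z hz
    apply DifferentiableAt.differentiableWithinAt
    apply DifferentiableAt.mul_const
    exact differentiableAt_id.cpow_const (Or.inl hz)
  have h1 : (1 : ℂ) ∈ {z : ℂ | 0 < z.re} := by simp
  have hconn : IsPreconnected {z : ℂ | 0 < z.re} :=
    (convex_halfSpace_re_gt 0).isPreconnected
  refine (hF.analyticOnNhd hopen).eqOn_of_preconnected_of_frequently_eq
    (hG.analyticOnNhd hopen) hconn h1 ?_ hr
  have ht : Filter.Tendsto (fun x : ℝ => (x : ℂ)) (nhdsWithin 1 {1}ᶜ) (nhdsWithin (1 : ℂ) {1}ᶜ) := by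
    apply tendsto_nhdsWithin_of_tendsto_nhds_of_eventually_within
    · exact (Complex.continuous_ofReal.tendsto' 1 1 (by simp)).mono_left nhdsWithin_le_nhds
    · filter_upwards [self_mem_nhdsWithin] with x hx
      simpa using hx
  refine ht.frequently (Filter.Eventually.frequently ?_)
  have : ∀ᶠ x : ℝ in nhdsWithin 1 {1}ᶜ, 0 < x :=
    nhdsWithin_le_nhds (lt_mem_nhds one_pos)
  filter_upwards [this] with x hx
  have := Complex.integral_cpow_mul_exp_neg_mul_Ioi ha hx
  rw [this, Complex.cpow_neg, one_div, Complex.inv_cpow]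
  rw [Complex.arg_ofReal_of_nonneg hx.le]
  exact Real.pi_pos.ne

lemma aux_core {V : Type*} [NormedAddCommGroup V] [InnerProductSpace ℝ V] [FiniteDimensional ℝ V]
    [MeasurableSpace V] [BorelSpace V] (s A : ℂ) (hA : 0 < A.re)
    (hs0 : 0 < s.re) (hs : (Module.finrank ℝ V : ℝ) / 2 < s.re) (η : V) :
    Integrable (fun Y : V => ((‖Y‖ : ℂ) ^ 2 + A) ^ (-s) *
        Complex.exp (2 * Real.pi * Complex.I * (⟪Y, η⟫ : ℝ))) ∧
    Complex.Gamma s * (∫ Y : V, ((‖Y‖ : ℂ) ^ 2 + A) ^ (-s) *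
        Complex.exp (2 * Real.pi * Complex.I * (⟪Y, η⟫ : ℝ))) =
      ∫ t : ℝ in Set.Ioi 0, (t : ℂ) ^ (s - 1) * Complex.exp (-(A * t)) *
        ((Real.pi / t : ℂ) ^ (Module.finrank ℝ V / 2 : ℂ) *
          Complex.exp ((2 * Real.pi * Complex.I) ^ 2 * ‖η‖ ^ 2 / (4 * t))) := by
  have hG : Complex.Gamma s ≠ 0 := Complex.Gamma_ne_zero_of_re_pos hs0
  set f : ℝ → V → ℂ := fun t Y => ((t : ℂ) ^ (s - 1) * Complex.exp (-(A * t))) *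
    Complex.exp (-(t : ℂ) * ‖Y‖ ^ 2 + (2 * Real.pi * Complex.I) * (⟪η, Y⟫ : ℝ)) with hf
  have hfn : ∀ t : ℝ, 0 < t → ∀ Y, ‖f t Y‖ = t ^ (s.re - 1) * Real.exp (-A.re * t) *
      Real.exp (-t * ‖Y‖ ^ 2) := by
    intro t ht Y
    rw [hf]
    simp only
    rw [norm_mul, aux_norm s A t ht, Complex.norm_exp]
    congr 2
    simp [← Complex.ofReal_pow]
  have hmeas : AEStronglyMeasurable (Function.uncurry f)
      ((volume.restrict (Set.Ioi (0 : ℝ))).prod (volume : Measure V)) := by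
    apply AEStronglyMeasurable.mul
    · exact ((aux_cont s A).aestronglyMeasurable measurableSet_Ioi).comp_fst
    · apply Continuous.aestronglyMeasurable
      fun_prop
  have hint : Integrable (Function.uncurry f)
      ((volume.restrict (Set.Ioi (0 : ℝ))).prod (volume : Measure V)) := by
    rw [integrable_prod_iff hmeas]
    constructor
    · filter_upwards [ae_restrict_mem measurableSet_Ioi] with t ht
      exact (GaussianFourier.integrable_cexp_neg_mul_sq_norm_add (b := (t : ℂ))
        (by simpa using ht) (2 * Real.pi * Complex.I) η).const_mul
          ((t : ℂ) ^ (s - 1) * Complex.exp (-(A * t)))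
    · have h0 := (aux_int (s.re - (Module.finrank ℝ V : ℝ) / 2) A.re (by linarith) hA).const_mul
        (Real.pi ^ ((Module.finrank ℝ V : ℝ) / 2))
      refine IntegrableOn.congr_fun h0 ?_ measurableSet_Ioi
      intro t ht
      have ht' : 0 < t := ht
      simp only [Function.uncurry]
      simp_rw [hfn t ht]
      rw [integral_const_mul, GaussianFourier.integral_rexp_neg_mul_sq_norm ht',
        Real.div_rpow Real.pi_pos.le ht'.le,
        show s.re - (Module.finrank ℝ V : ℝ) / 2 - 1 = s.re - 1 - (Module.finrank ℝ V : ℝ) / 2 by ring,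
        Real.rpow_sub ht']
      ring
  have hin : ∀ Y : V, ∫ t : ℝ in Set.Ioi 0, f t Y = Complex.Gamma s *
      (((‖Y‖ : ℂ) ^ 2 + A) ^ (-s) *
        Complex.exp (2 * Real.pi * Complex.I * (⟪Y, η⟫ : ℝ))) := by
    intro Y
    have hr : 0 < ((‖Y‖ : ℂ) ^ 2 + A).re := by
      rw [← Complex.ofReal_pow, Complex.add_re, Complex.ofReal_re]; positivity
    have := aux_gamma_s15 s _ hs0 hr
    rw [mul_comm, mul_right_comm, ← this, ← integral_mul_const]
    refine integral_congr_ae (Filter.Eventually.of_forall fun t => ?_)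
    simp only [hf]
    rw [mul_assoc _ _ (Complex.exp (_ + _)), mul_assoc _ _ (Complex.exp (_ * Complex.ofReal _)),
      ← Complex.exp_add, ← Complex.exp_add, real_inner_comm]
    congr 2
    ring
  have hout : ∀ t ∈ Set.Ioi (0 : ℝ), ∫ Y, f t Y = (t : ℂ) ^ (s - 1) * Complex.exp (-(A * t)) *
        ((Real.pi / t : ℂ) ^ (Module.finrank ℝ V / 2 : ℂ) *
          Complex.exp ((2 * Real.pi * Complex.I) ^ 2 * ‖η‖ ^ 2 / (4 * t))) := by
    intro t ht
    simp only [hf]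
    rw [integral_const_mul, GaussianFourier.integral_cexp_neg_mul_sq_norm_add
      (b := (t : ℂ)) (by simpa using ht)]
  constructor
  · have h1 := (hint.integral_prod_right).const_mul (Complex.Gamma s)⁻¹
    refine h1.congr (Filter.Eventually.of_forall fun Y => ?_)
    simp only [Function.uncurry]
    rw [hin Y, inv_mul_cancel_left₀ hG]
  · rw [← integral_const_mul]
    simp_rw [← hin]
    rw [← integral_integral_swap hint]
    exact setIntegral_congr_fun measurableSet_Ioi hout

lemma aux_half (g : ℝ → ℂ) (r : ℝ)
    (hg : Integrable fun u : ℝ => g (u ^ 2) *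
      Complex.exp (2 * Real.pi * Complex.I * (r * u : ℝ))) :
    IntegrableOn (fun u : ℝ => g (u ^ 2) * (Real.cos (2 * Real.pi * r * u) : ℂ)) (Set.Ioi 0) ∧
    ∫ u : ℝ, g (u ^ 2) * Complex.exp (2 * Real.pi * Complex.I * (r * u : ℝ)) =
      2 * ∫ u : ℝ in Set.Ioi 0, g (u ^ 2) * (Real.cos (2 * Real.pi * r * u) : ℂ) := by
  have hn := hg.comp_neg
  have heq : ∀ u : ℝ, g ((-u) ^ 2) * Complex.exp (2 * Real.pi * Complex.I * (r * (-u) : ℝ)) +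
      g (u ^ 2) * Complex.exp (2 * Real.pi * Complex.I * (r * u : ℝ)) =
      2 * (g (u ^ 2) * (Real.cos (2 * Real.pi * r * u) : ℂ)) := by
    intro u
    rw [Complex.ofReal_cos, Complex.cos, neg_sq]
    push_cast
    rw [show 2 * (Real.pi : ℂ) * Complex.I * (r * -u) = -(2 * Real.pi * r * u) * Complex.I by ring,
      show 2 * (Real.pi : ℂ) * Complex.I * (r * u) = (2 * Real.pi * r * u) * Complex.I by ring]
    ring
  have hs := hn.add hg
  constructor
  · refine ((hs.const_mul (1 / 2 : ℂ)).congr (Filter.Eventually.of_forall fun u => ?_)).integrableOn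
    simp only [Pi.add_apply]
    rw [heq u]
    ring
  · rw [← integral_const_mul]
    simp_rw [← heq]
    rw [integral_add hn.integrableOn hg.integrableOn,
      integral_comp_neg_Ioi 0
        (fun u : ℝ => g (u ^ 2) * Complex.exp (2 * Real.pi * Complex.I * (r * u : ℝ))), neg_zero,
      ← setIntegral_union (Set.Iic_disjoint_Ioi le_rfl) measurableSet_Ioi
        hg.integrableOn hg.integrableOn, Set.Iic_union_Ioi, setIntegral_univ]

/-- For `Re A > 0` and `2 Re α < -(m-2)`, `ρ = (m-1)/2`, both integrals
below converge absolutely, and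
`∫_{ℝ^{m-2}} (‖Y‖² + A)^α e^{2πi⟨Y,η⟩} dY
  = 2π^{ρ-1} Γ(-α-ρ+1)/Γ(-α) ∫₀^∞ (u² + A)^{α+ρ-1} cos(2π‖η‖u) du`. -/
theorem stmt15 (m : ℕ) (hm : 3 ≤ m) (α A : ℂ) (hA : 0 < A.re)
    (hα : 2 * α.re < -((m : ℝ) - 2)) (η : EuclideanSpace ℝ (Fin (m - 2))) :
    (Integrable fun Y : EuclideanSpace ℝ (Fin (m - 2)) =>
      ((‖Y‖ : ℂ) ^ 2 + A) ^ α *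
        Complex.exp (2 * Real.pi * Complex.I * (⟪Y, η⟫ : ℝ))) ∧
    IntegrableOn (fun u : ℝ =>
      ((u : ℂ) ^ 2 + A) ^ (α + ((m : ℂ) - 1) / 2 - 1) *
        (Real.cos (2 * Real.pi * ‖η‖ * u) : ℂ)) (Set.Ioi 0) ∧
    (∫ Y : EuclideanSpace ℝ (Fin (m - 2)),
        ((‖Y‖ : ℂ) ^ 2 + A) ^ α *
          Complex.exp (2 * Real.pi * Complex.I * (⟪Y, η⟫ : ℝ)))
      = 2 * (Real.pi : ℂ) ^ (((m : ℂ) - 1) / 2 - 1) *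
          (Complex.Gamma (-α - ((m : ℂ) - 1) / 2 + 1) / Complex.Gamma (-α)) *
          ∫ u in Set.Ioi (0 : ℝ),
            ((u : ℂ) ^ 2 + A) ^ (α + ((m : ℂ) - 1) / 2 - 1) *
              (Real.cos (2 * Real.pi * ‖η‖ * u) : ℂ) := by
  have hmr : (3 : ℝ) ≤ m := by exact_mod_cast hm
  have hfr : (Module.finrank ℝ (EuclideanSpace ℝ (Fin (m - 2))) : ℕ) = m - 2 := by simp
  have hc : ((m - 2 : ℕ) : ℝ) = (m : ℝ) - 2 := by
    rw [Nat.cast_sub (by omega)]; norm_num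
  have hcc : ((m - 2 : ℕ) : ℂ) = (m : ℂ) - 2 := by
    rw [Nat.cast_sub (by omega)]; norm_num
  obtain ⟨hI1, hE1⟩ := aux_core (V := EuclideanSpace ℝ (Fin (m - 2))) (-α) A hA
    (by rw [Complex.neg_re]; linarith) (by rw [hfr, hc, Complex.neg_re]; linarith) η
  set s' : ℂ := -α - ((m : ℂ) - 1) / 2 + 1 with hs'
  have hs're : s'.re = -α.re - ((m : ℝ) - 1) / 2 + 1 := by
    have : s' = ((-((m : ℝ) - 1) / 2 + 1 : ℝ) : ℂ) - α := by rw [hs']; push_cast; ring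
    rw [this, Complex.sub_re, Complex.ofReal_re]; ring
  obtain ⟨hI2, hE2⟩ := aux_core (V := ℝ) s' A hA
    (by rw [hs're]; linarith) (by rw [hs're, Module.finrank_self]; push_cast; linarith) ‖η‖
  have hsub : ∀ u : ℝ, ((‖u‖ : ℂ) ^ 2 + A) ^ (-s') *
        Complex.exp (2 * Real.pi * Complex.I * (⟪u, ‖η‖⟫ : ℝ)) =
      (fun x : ℝ => ((x : ℂ) + A) ^ (α + ((m : ℂ) - 1) / 2 - 1)) (u ^ 2) *
        Complex.exp (2 * Real.pi * Complex.I * (‖η‖ * u : ℝ)) := by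
    intro u
    have h1 : -s' = α + ((m : ℂ) - 1) / 2 - 1 := by rw [hs']; ring
    have h2 : (‖u‖ : ℂ) ^ 2 = ((u ^ 2 : ℝ) : ℂ) := by
      rw [← Complex.ofReal_pow, Real.norm_eq_abs, sq_abs]
    simp only [h1, h2]
    simp [mul_comm]
  simp_rw [hsub] at hI2 hE2
  obtain ⟨hI3, hE3⟩ := aux_half (fun x : ℝ => ((x : ℂ) + A) ^ (α + ((m : ℂ) - 1) / 2 - 1)) ‖η‖ hI2
  simp only [neg_neg] at hI1 hE1
  simp only [Complex.ofReal_pow] at hI3 hE3 hE2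
  refine ⟨hI1, hI3, ?_⟩
  rw [hE3] at hE2
  have hG : Complex.Gamma (-α) ≠ 0 :=
    Complex.Gamma_ne_zero_of_re_pos (by rw [Complex.neg_re]; linarith)
  apply mul_left_cancel₀ hG
  rw [hE1]
  have : ∀ C X P : ℂ, Complex.Gamma (-α) * (2 * P * (C / Complex.Gamma (-α)) * X) =
      P * (C * (2 * X)) := by
    intro C X P
    field_simp
  rw [this, hE2, ← integral_const_mul]
  refine setIntegral_congr_fun measurableSet_Ioi fun t ht => ?_
  have ht' : 0 < t := ht
  have htc : (t : ℂ) ≠ 0 := by exact_mod_cast ht'.ne'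
  have hpc : (Real.pi : ℂ) ≠ 0 := by exact_mod_cast Real.pi_pos.ne'
  simp only [hfr, hcc, Module.finrank_self, Complex.div_cpow_ofReal_nonneg Real.pi_pos.le ht'.le,
    norm_norm]
  have e1 : (Real.pi : ℂ) ^ (((m : ℂ) - 2) / 2) =
      (Real.pi : ℂ) ^ (((m : ℂ) - 1) / 2 - 1) * (Real.pi : ℂ) ^ (((1 : ℕ) : ℂ) / 2) := by
    rw [← Complex.cpow_add _ _ hpc]; congr 1; push_cast; ring
  have e2 : (t : ℂ) ^ (-α - 1) / (t : ℂ) ^ (((m : ℂ) - 2) / 2) =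
      (t : ℂ) ^ (s' - 1) / (t : ℂ) ^ (((1 : ℕ) : ℂ) / 2) := by
    rw [← Complex.cpow_sub _ _ htc, ← Complex.cpow_sub _ _ htc]; congr 1; rw [hs']; push_cast; ring
  rw [e1]
  set E1 := Complex.exp (-(A * t))
  set E2 := Complex.exp ((2 * Real.pi * Complex.I) ^ 2 * ‖η‖ ^ 2 / (4 * t))
  set P1 := (Real.pi : ℂ) ^ (((m : ℂ) - 1) / 2 - 1)
  set P2 := (Real.pi : ℂ) ^ (((1 : ℕ) : ℂ) / 2)
  calc _ = P1 * P2 * E1 * E2 * ((t : ℂ) ^ (-α - 1) / (t : ℂ) ^ (((m : ℂ) - 2) / 2)) := by ring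
    _ = _ := by rw [e2]; ring
end
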